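/- arXiv:1101.3773 — 3 statements merged into one kernel-verified Lean document; each statement's English description precedes it below -/
import Mathlib

section
/- Let W = {(x,y,z) ∈ ℝ³ : x ≤ 0, y ≤ 0, z ≤ 0}. For every finite set P of points of ℝ³ there exists a coloring χ : P → {red, blue} such that for every t ∈ ℝ³, if the translate t + W contains at least 12 points of P, then t + W contains at least one red point of P and at least one blue point of P. -/
namespace OctantColoring

open Finset

section Definitions

variable {α L : Type*} [LinearOrder L]

/-- `p` lies strictly below `q` in the projection to the first two coordinates. -/
def Below (X Y : α → L) (p q : α) : Prop := X p < X q ∧ Y p < Y q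

/-- `p` is a planar minimal point of `S`. -/
def Alive (X Y : α → L) (S : Finset α) (p : α) : Prop :=
  p ∈ S ∧ ∀ q ∈ S, ¬ Below X Y q p

/-- `v` is the lowest point of `S` whose projection lies below that of `d`. -/
def Killer (X Y Z : α → L) (S : Finset α) (v d : α) : Prop :=
  v ∈ S ∧ Below X Y v d ∧ ∀ q ∈ S, Below X Y q d → Z v ≤ Z q

/-- `v` is the leftmost point of `S` that precedes `w` in both the `Y` and the `Z` order. -/
def Parent (X Y Z : α → L) (S : Finset α) (w v : α) : Prop :=
  v ∈ S ∧ Z v < Z w ∧ Y v < Y w ∧ ∀ q ∈ S, Z q < Z w → Y q < Y w → X v ≤ X q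

/-- `p` and `q` are consecutive planar minimal points of `S`, with `p` to the left of `q`. -/
def Nb (X Y : α → L) (S : Finset α) (p q : α) : Prop :=
  p ∈ S ∧ q ∈ S ∧ X p < X q ∧ Y q < Y p ∧ ∀ r ∈ S, ¬ (X r < X q ∧ Y r < Y p)

/-- The window `(-∞, a] × (-∞, b]` is certain to receive both colors. -/
def Good (X Y : α → L) (S : Finset α) (col : α → Option Bool) (a b : L) : Prop :=
  (∃ p ∈ S, ∃ q ∈ S, X p ≤ a ∧ Y p ≤ b ∧ X q ≤ a ∧ Y q ≤ b ∧
    col p = some true ∧ col q = some false) ∨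
  ∃ p ∈ S, X p ≤ a ∧ Y p ≤ b ∧ col p = none ∧ ¬ Alive X Y S p

/-- `d` is a dead colored point whose own window is not known to receive both colors. -/
def Bad (X Y : α → L) (S : Finset α) (col : α → Option Bool) (d : α) : Prop :=
  d ∈ S ∧ ¬ Alive X Y S d ∧ col d ≠ none ∧ ¬ Good X Y S col (X d) (Y d)

/-- `w` is an uncolored minimal point below `d` which is the killer of `d` or has the killer
of `d` as one of its two parents. -/
def Protects (X Y Z : α → L) (S : Finset α) (col : α → Option Bool) (w d : α) : Prop :=
  Alive X Y S w ∧ col w = none ∧ Below X Y w d ∧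
    (Killer X Y Z S w d ∨
      ∃ v, Killer X Y Z S v d ∧ (Parent X Y Z S w v ∨ Parent Y X Z S w v))

/-- The invariant maintained by the partial coloring. -/
structure Inv (X Y Z : α → L) (S : Finset α) (col : α → Option Bool) : Prop where
  mem : ∀ p c, col p = some c → p ∈ S
  nb : ∀ p q c, Nb X Y S p q → col p = some c → col q ≠ some c
  prot : ∀ d, Bad X Y S col d → ∃ w, Protects X Y Z S col w d
  kil : ∀ d d' v c, d ≠ d' → Killer X Y Z S v d → Killer X Y Z S v d' →
    col d = some c → col d' = some c →
    ∀ a b, X d ≤ a → X d' ≤ a → Y d ≤ b → Y d' ≤ b → Good X Y S col a b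

open Classical in
/-- No further minimal point can be colored without violating the invariant. -/
def Maximal (X Y Z : α → L) (S : Finset α) (col : α → Option Bool) : Prop :=
  ∀ w c, Alive X Y S w → col w = none → ¬ Inv X Y Z S (Function.update col w (some c))

end Definitions

variable {α L : Type*} [LinearOrder L] {X Y Z : α → L} {S T : Finset α}
  {col col' : α → Option Bool} {a b : L}

section Swap

theorem below_swap {p q : α} : Below Y X p q ↔ Below X Y p q := and_comm

theorem alive_swap {p : α} : Alive Y X S p ↔ Alive X Y S p := by
  simp only [Alive, below_swap]

theorem killer_swap {v d : α} : Killer Y X Z S v d ↔ Killer X Y Z S v d := by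
  simp only [Killer, below_swap (X := X) (Y := Y)]

theorem nb_swap {p q : α} : Nb Y X S q p ↔ Nb X Y S p q := by
  unfold Nb; grind

theorem good_swap : Good Y X S col b a ↔ Good X Y S col a b := by
  simp only [Good, alive_swap (X := X) (Y := Y)]; grind

theorem bad_swap {d : α} : Bad Y X S col d ↔ Bad X Y S col d := by
  simp only [Bad, alive_swap (X := X) (Y := Y), good_swap (X := X) (Y := Y)]

theorem protects_swap {w d : α} : Protects Y X Z S col w d ↔ Protects X Y Z S col w d := by
  simp only [Protects, alive_swap (X := X) (Y := Y), below_swap (X := X) (Y := Y),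
    killer_swap (X := X) (Y := Y), or_comm (a := Parent Y X Z S w _)]

theorem Inv.swap (h : Inv X Y Z S col) : Inv Y X Z S col where
  mem := h.mem
  nb p q c hpq hp hq := h.nb q p c (nb_swap.1 hpq) hq hp
  prot d hd := by
    obtain ⟨w, hw⟩ := h.prot d (bad_swap.1 hd)
    exact ⟨w, protects_swap.2 hw⟩
  kil d d' v c hne h₁ h₂ h₃ h₄ a b h₅ h₆ h₇ h₈ :=
    good_swap.2 (h.kil d d' v c hne (killer_swap.1 h₁) (killer_swap.1 h₂) h₃ h₄ b a h₇ h₈ h₅ h₆)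

theorem Maximal.swap (h : Maximal X Y Z S col) : Maximal Y X Z S col :=
  fun w c hw hc hI => h w c (alive_swap.1 hw) hc hI.swap

end Swap

section Basic

theorem Alive.lt_of_lt (hY : Y.Injective) {p q : α} (hp : Alive X Y S p) (hq : Alive X Y S q)
    (h : X p < X q) : Y q < Y p := by
  have h₁ : ¬ Y p < Y q := fun h' => hq.2 p hp.1 ⟨h, h'⟩
  refine lt_of_le_of_ne (not_lt.1 h₁) fun h' => ?_
  rw [hY h'] at h
  exact lt_irrefl _ h

theorem Nb.alive_left {p q : α} (h : Nb X Y S p q) : Alive X Y S p :=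
  ⟨h.1, fun r hr hb => h.2.2.2.2 r hr ⟨hb.1.trans h.2.2.1, hb.2⟩⟩

theorem Nb.alive_right {p q : α} (h : Nb X Y S p q) : Alive X Y S q :=
  (nb_swap.2 h).alive_left |> alive_swap.1

theorem exists_left_nb (hY : Y.Injective) {w r : α} (hw : Alive X Y S w) (hr : r ∈ S)
    (h : X r < X w) : ∃ m, Nb X Y S m w := by
  classical
  obtain ⟨m, hm, hmin⟩ := (S.filter (X · < X w)).exists_min_image Y ⟨r, by simp [hr, h]⟩
  simp only [mem_filter, and_imp] at hm hmin
  refine ⟨m, hm.1, hw.1, hm.2, ?_, fun r hr h' => not_lt.2 (hmin r hr h'.1) h'.2⟩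
  refine lt_of_le_of_ne (not_lt.1 fun h' => hw.2 m hm.1 ⟨hm.2, h'⟩) fun h' => ?_
  exact lt_irrefl _ (hY h' ▸ hm.2)

theorem exists_right_nb (hX : X.Injective) {w r : α} (hw : Alive X Y S w) (hr : r ∈ S)
    (h : Y r < Y w) : ∃ m, Nb X Y S w m := by
  obtain ⟨m, hm⟩ := exists_left_nb hX (alive_swap.2 hw) hr h
  exact ⟨m, nb_swap.1 hm⟩

theorem Nb.left_unique (hY : Y.Injective) {m m' w : α} (h : Nb X Y S m w)
    (h' : Nb X Y S m' w) : m = m' := by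
  unfold Nb at h h'
  apply hY
  grind

theorem Nb.right_unique (hX : X.Injective) {m m' w : α} (h : Nb X Y S w m)
    (h' : Nb X Y S w m') : m = m' :=
  (nb_swap.2 h).left_unique hX (nb_swap.2 h')

theorem Parent.unique (hX : X.Injective) {w v v' : α} (h : Parent X Y Z S w v)
    (h' : Parent X Y Z S w v') : v = v' :=
  hX (le_antisymm (h.2.2.2 _ h'.1 h'.2.1 h'.2.2.1) (h'.2.2.2 _ h.1 h.2.1 h.2.2.1))

theorem Nb.parent_left {m w : α} (h : Nb X Y S m w) (hZ : Z w < Z m) : Parent X Y Z S m w :=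
  ⟨h.2.1, hZ, h.2.2.2.1, fun q hq _ hy => not_lt.1 fun hx => h.2.2.2.2 q hq ⟨hx, hy⟩⟩

theorem Nb.parent_right {m w : α} (h : Nb X Y S m w) (hZ : Z m < Z w) : Parent Y X Z S w m :=
  (nb_swap.2 h).parent_left hZ

/-- Goodness persists when points are inserted and uncolored living points get colored. -/
theorem Good.mono (h : Good X Y S col a b) (hST : S ⊆ T)
    (hcol : ∀ p ∈ S, col' p = col p ∨ col p = none ∧ Alive X Y S p) : Good X Y T col' a b := by
  rcases h with ⟨p, hp, q, hq, h⟩ | ⟨p, hp, hpa, hpb, hpn, hpd⟩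
  · refine Or.inl ⟨p, hST hp, q, hST hq, ?_⟩
    have := hcol p hp
    have := hcol q hq
    grind
  · refine Or.inr ⟨p, hST hp, hpa, hpb, ?_, fun h' => hpd ⟨hp, fun q hq => h'.2 q (hST hq)⟩⟩
    have := hcol p hp
    grind

theorem good_of_ne {p q : α} {c : Bool} (hp : p ∈ S) (hq : q ∈ S) (hpa : X p ≤ a) (hpb : Y p ≤ b)
    (hqa : X q ≤ a) (hqb : Y q ≤ b) (h : col p = some c) (h' : col q = some !c) :
    Good X Y S col a b := by
  cases c
  · exact Or.inl ⟨q, hq, p, hp, hqa, hqb, hpa, hpb, h', h⟩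
  · exact Or.inl ⟨p, hp, q, hq, hpa, hpb, hqa, hqb, h, h'⟩

theorem Bad.window {d : α} {c : Bool} (h : Bad X Y S col d) (hc : col d = some c) {p : α}
    (hp : p ∈ S) (hx : X p ≤ X d) (hy : Y p ≤ Y d) :
    col p = some c ∨ col p = none ∧ Alive X Y S p := by
  obtain ⟨hd, -, -, hg⟩ := h
  rcases hcp : col p with _ | c'
  · exact Or.inr ⟨rfl, by_contra fun h' => hg (Or.inr ⟨p, hp, hx, hy, hcp, h'⟩)⟩
  · left
    by_contra h'
    refine hg (good_of_ne (c := c) hd hp le_rfl le_rfl hx hy hc ?_)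
    cases c <;> cases c' <;> simp_all

end Basic

section Insertion

theorem Inv.insert_top [DecidableEq α] (hX : X.Injective) (hY : Y.Injective) {p : α}
    (h : Inv X Y Z S col) (hpZ : ∀ q ∈ S, Z q < Z p) (hp : ∀ q ∈ S, ¬ Below X Y q p) :
    Inv X Y Z (insert p S) col := by
  have hpS : p ∉ S := fun h' => lt_irrefl _ (hpZ p h')
  have hgood : ∀ {a b}, Good X Y S col a b → Good X Y (insert p S) col a b :=
    fun hg => hg.mono (subset_insert p S) fun _ _ => Or.inl rfl
  have hpn : col p = none := by
    by_contra h'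
    obtain ⟨c, hc⟩ := Option.ne_none_iff_exists'.1 h'
    exact hpS (h.mem p c hc)
  refine ⟨fun q c hq => mem_insert_of_mem (h.mem q c hq), fun x y c hxy hx hy => ?_,
    fun d hd => ?_, ?_⟩
  · exact h.nb x y c ⟨h.mem _ _ hx, h.mem _ _ hy, hxy.2.2.1, hxy.2.2.2.1,
      fun r hr => hxy.2.2.2.2 r (mem_insert_of_mem hr)⟩ hx hy
  · obtain ⟨c, hc⟩ := Option.ne_none_iff_exists'.1 hd.2.2.1
    have hdS := h.mem d c hc
    by_cases hda : Alive X Y S d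
    · obtain ⟨q, hq, hqd⟩ : ∃ q ∈ insert p S, Below X Y q d := by
        have := hd.2.1
        unfold Alive at this
        grind
      have key : ∀ q ∈ insert p S, Below X Y q d → q = p := fun q hq hqd =>
        (mem_insert.1 hq).resolve_right fun h' => hda.2 q h' hqd
      obtain rfl := key q hq hqd
      refine ⟨q, ⟨hq, fun r hr hrq => ?_⟩, hpn, hqd,
        Or.inl ⟨hq, hqd, fun r hr hrd => (congrArg Z (key r hr hrd)).ge⟩⟩
      rcases mem_insert.1 hr with rfl | hr
      · exact lt_irrefl _ hrq.1
      · exact hp r hr hrq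
    · obtain ⟨w, hwa, hwn, hwd, hw⟩ := h.prot d
        ⟨hdS, hda, hd.2.2.1, fun hg => hd.2.2.2 (hgood hg)⟩
      have hkil : ∀ v, Killer X Y Z S v d → Killer X Y Z (insert p S) v d := by
        intro v hv
        refine ⟨mem_insert_of_mem hv.1, hv.2.1, fun q hq hqd => ?_⟩
        rcases mem_insert.1 hq with rfl | hq
        · exact (hpZ v hv.1).le
        · exact hv.2.2 q hq hqd
      have hpar : ∀ v, (Parent X Y Z S w v → Parent X Y Z (insert p S) w v) ∧
          (Parent Y X Z S w v → Parent Y X Z (insert p S) w v) := by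
        have := hpZ w hwa.1
        unfold Parent
        grind
      refine ⟨w, by_contra fun h' => hd.2.2.2 ?_, hwn, hwd, ?_⟩
      · exact Or.inr ⟨w, mem_insert_of_mem hwa.1, hwd.1.le, hwd.2.le, hwn, h'⟩
      · exact hw.imp (hkil w) fun ⟨v, hv, hv'⟩ =>
          ⟨v, hkil v hv, hv'.imp (hpar v).1 (hpar v).2⟩
  · intro d d' v c hne hd hd' hc hc' a b h₁ h₂ h₃ h₄
    rcases mem_insert.1 hd.1 with rfl | hv
    · have hal : ∀ e, col e = some c → Killer X Y Z (insert v S) v e → Alive X Y S e :=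
        fun e he hk => ⟨h.mem e c he, fun q hq hqe =>
          not_lt.2 (hk.2.2 q (mem_insert_of_mem hq) hqe) (hpZ q hq)⟩
      wlog hlt : X d < X d' generalizing d d'
      · exact this d' d hne.symm hc' hc h₂ h₁ h₄ h₃ hd' hd
          (lt_of_le_of_ne (not_lt.1 hlt) fun h' => hne (hX h').symm)
      have had := hal d hc hd
      have had' := hal d' hc' hd'
      obtain ⟨s, hs⟩ := exists_right_nb hX had had'.1 (had.lt_of_lt hY had' hlt)
      have hsa := hs.alive_right
      have hsd' : X s < X d' := by
        refine lt_of_le_of_ne (not_lt.1 fun h' =>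
          hs.2.2.2.2 d' had'.1 ⟨h', had.lt_of_lt hY had' hlt⟩) fun h' => ?_
        rw [hX h'] at hs
        exact h.nb d d' c hs hc hc'
      have hy := hsa.lt_of_lt hY had' hsd'
      have hsS := mem_insert_of_mem (b := v) hsa.1
      have hsw : X s ≤ a ∧ Y s ≤ b := ⟨hsd'.le.trans h₂, hs.2.2.2.1.le.trans h₃⟩
      rcases hcs : col s with _ | c'
      · exact Or.inr ⟨s, hsS, hsw.1, hsw.2, hcs, fun h' =>
          h'.2 v hd.1 ⟨hd.2.1.1.trans hs.2.2.1, hd'.2.1.2.trans hy⟩⟩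
      · have hne' := h.nb d s c hs hc
        refine good_of_ne (c := c) (mem_insert_of_mem had.1) hsS h₁ h₃ hsw.1 hsw.2 hc ?_
        cases c <;> cases c' <;> simp_all
    · have hres : ∀ e, Killer X Y Z (insert p S) v e → Killer X Y Z S v e :=
        fun e he => ⟨hv, he.2.1, fun q hq => he.2.2 q (mem_insert_of_mem hq)⟩
      exact hgood (h.kil d d' v c hne (hres d hd) (hres d' hd') hc hc' a b h₁ h₂ h₃ h₄)

end Insertion

section Extension

theorem Inv.exists_maximal (h : Inv X Y Z S col) : ∃ col', Inv X Y Z S col' ∧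
    Maximal X Y Z S col' ∧ ∀ p, col' p = col p ∨ col p = none ∧ Alive X Y S p := by
  classical
  induction hn : #{p ∈ S | col p = none} using Nat.strong_induction_on generalizing col with
  | _ n ih =>
    by_cases hM : Maximal X Y Z S col
    · exact ⟨col, h, hM, fun _ => Or.inl rfl⟩
    · simp only [Maximal, not_forall, not_not] at hM
      obtain ⟨w, c, hw, hc, hI⟩ := hM
      obtain ⟨col', hI', hM', hcol'⟩ := ih _ (hn ▸ card_lt_card (by
        refine (ssubset_iff_of_subset fun p => ?_).2 ⟨w, ?_, ?_⟩
        · simp only [mem_filter, Function.update_apply]; grind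
        · simp [hw.1, hc]
        · simp)) hI rfl
      refine ⟨col', hI', hM', fun p => ?_⟩
      have := hcol' p
      simp only [Function.update_apply] at this
      grind

/-- In a maximal coloring, an uncolored minimal point can be denied the color `c` only by an
adjacent point of color `c`, or by a bad point of color `c` that it alone protects. -/
theorem Inv.block (h : Inv X Y Z S col) (hM : Maximal X Y Z S col) {w : α}
    (hw : Alive X Y S w) (hwn : col w = none) (c : Bool) :
    (∃ q, (Nb X Y S q w ∨ Nb X Y S w q) ∧ col q = some c) ∨
      ∃ d, Bad X Y S col d ∧ col d = some c ∧ Protects X Y Z S col w d ∧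
        ∀ w', Protects X Y Z S col w' d → w' = w := by
  classical
  by_contra! hcon
  obtain ⟨h₁, h₂⟩ := hcon
  have hup : ∀ p, p ≠ w → Function.update col w (some c) p = col p := fun p hp => by simp [hp]
  have hgood : ∀ {a b}, Good X Y S col a b → Good X Y S (Function.update col w (some c)) a b :=
    fun hg => hg.mono Subset.rfl fun p _ => by
      by_cases hp : p = w
      · subst hp; exact Or.inr ⟨hwn, hw⟩
      · exact Or.inl (hup p hp)
  refine hM w c hw hwn ⟨fun p c' hp => ?_, fun p q c' hpq hp hq => ?_, fun d hd => ?_, ?_⟩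
  · by_cases hpw : p = w
    · exact hpw ▸ hw.1
    · exact h.mem p c' (hup p hpw ▸ hp)
  · have hne : p ≠ q := fun h' => lt_irrefl _ (h' ▸ hpq.2.2.1)
    by_cases hpw : p = w
    · subst hpw
      rw [hup q hne.symm] at hq
      obtain rfl : c = c' := by simpa using hp
      exact h₁ q (Or.inr hpq) hq
    · rw [hup p hpw] at hp
      by_cases hqw : q = w
      · subst hqw
        obtain rfl : c = c' := by simpa using hq
        exact h₁ p (Or.inl hpq) hp
      · exact h.nb p q c' hpq hp (hup q hqw ▸ hq)
  · have hdw : d ≠ w := fun h' => hd.2.1 (h' ▸ hw)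
    have hbad : Bad X Y S col d :=
      ⟨hd.1, hd.2.1, hup d hdw ▸ hd.2.2.1, fun hg => hd.2.2.2 (hgood hg)⟩
    have hpres : ∀ w', w' ≠ w → Protects X Y Z S col w' d →
        Protects X Y Z S (Function.update col w (some c)) w' d := fun w' hne hp =>
      ⟨hp.1, (hup w' hne).trans hp.2.1, hp.2.2⟩
    obtain ⟨w', hw'⟩ := h.prot d hbad
    by_cases hww : w' = w
    · subst hww
      have hdc : col d = some c := by
        obtain ⟨c', hc'⟩ := Option.ne_none_iff_exists'.1 hd.2.2.1
        have := hd.window hc' hw.1 hw'.2.2.1.1.le hw'.2.2.1.2.le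
        rw [hup d hdw] at hc'
        simpa [hc', eq_comm] using this
      obtain ⟨w'', hp, hne⟩ := h₂ d hbad hdc hw'
      exact ⟨w'', hpres w'' hne hp⟩
    · exact ⟨w', hpres w' hww hw'⟩
  · intro d d' v c' hne hd hd' hc hc' a b h₁ h₂ h₃ h₄
    have hdead : ∀ e, Killer X Y Z S v e → e ≠ w := fun e he h' =>
      hw.2 v he.1 (h' ▸ he.2.1)
    rw [hup d (hdead d hd)] at hc
    rw [hup d' (hdead d' hd')] at hc'
    exact hgood (h.kil d d' v c' hne hd hd' hc hc' a b h₁ h₂ h₃ h₄)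

end Extension

section Window

/-- A maximal coloring together with a window that is not good: every point of the window has
color `R`, or is minimal and uncolored. -/
structure Mono (X Y Z : α → L) (S : Finset α) (col : α → Option Bool) (a b : L) (R : Bool) :
    Prop where
  injX : X.Injective
  injY : Y.Injective
  injZ : Z.Injective
  inv : Inv X Y Z S col
  maxi : Maximal X Y Z S col
  mono : ∀ p ∈ S, X p ≤ a → Y p ≤ b → col p = some R ∨ col p = none ∧ Alive X Y S p

variable {R : Bool}

theorem Mono.swap (C : Mono X Y Z S col a b R) : Mono Y X Z S col b a R :=
  ⟨C.injY, C.injX, C.injZ, C.inv.swap, C.maxi.swap, fun p hp hb ha => by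
    simpa only [alive_swap (X := X) (Y := Y)] using C.mono p hp ha hb⟩

theorem Protects.parent_killer {w d : α} (h : Protects X Y Z S col w d)
    (hu : ∀ w', Protects X Y Z S col w' d → w' = w) (hk : ¬ Killer X Y Z S w d) {c : Bool}
    (hd : Bad X Y S col d) (hc : col d = some c) :
    ∃ v, Killer X Y Z S v d ∧ col v = some c ∧
      (Parent X Y Z S w v ∨ Parent Y X Z S w v) := by
  obtain ⟨v, hv, hp⟩ := h.2.2.2.resolve_left hk
  refine ⟨v, hv, ?_, hp⟩
  refine (hd.window hc hv.1 hv.2.1.1.le hv.2.1.2.le).resolve_right fun h' => ?_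
  have := hu v ⟨h'.2, h'.1, hv.2.1, Or.inl hv⟩
  exact hk (this ▸ hv)

/-- If `w` alone protects `d`, and the left neighbor of `w` is uncolored and lies below `d`,
then `w` is not the killer of `d`. -/
theorem Nb.not_killer (hZ : Z.Injective) {m w d : α} (hm : Nb X Y S m w) (hmn : col m = none)
    (hmd : Below X Y m d) (hu : ∀ w', Protects X Y Z S col w' d → w' = w) :
    ¬ Killer X Y Z S w d := fun hk => by
  have hlt : Z w < Z m := by
    refine lt_of_le_of_ne (hk.2.2 m hm.1 hmd) fun h' => ?_
    exact lt_irrefl _ (hZ h' ▸ hm.2.2.1)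
  have := hu m ⟨hm.alive_left, hmn, hmd, Or.inr ⟨w, hk, Or.inl (hm.parent_left hlt)⟩⟩
  exact lt_irrefl _ (this ▸ hm.2.2.1)

/-- If a bad point `d` above the window is protected by `w` alone, then the left neighbor of `w`
is uncolored and `w` is not the killer of `d`. -/
theorem Mono.left_nb (C : Mono X Y Z S col a b R) {m w d : α} (hm : Nb X Y S m w)
    (hma : X m ≤ a) (hmb : Y m ≤ b) (hd : Bad X Y S col d) (hc : col d = some !R)
    (hw : Protects X Y Z S col w d) (hu : ∀ w', Protects X Y Z S col w' d → w' = w)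
    (hdb : b < Y d) : col m = none ∧ ¬ Killer X Y Z S w d := by
  have hmd : Below X Y m d := ⟨hm.2.2.1.trans hw.2.2.1.1, hmb.trans_lt hdb⟩
  have hmn : col m = none := by
    have h₁ := C.mono m hm.1 hma hmb
    have h₂ := hd.window hc hm.1 hmd.1.le hmd.2.le
    cases R <;> grind
  exact ⟨hmn, hm.not_killer C.injZ hmn hmd hu⟩

theorem Bad.not_window {d e : α} (hd : Bad X Y S col d) (hc : col d = some !R)
    (he : Bad X Y S col e) (hce : col e = some R) : X d < X e ∨ Y d < Y e := by
  by_contra! h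
  have := hd.window hc he.1 h.1 h.2
  cases R <;> simp_all

theorem Mono.left_nb_newer (C : Mono X Y Z S col a b R) {m w d : α} (hm : Nb X Y S m w)
    (hma : X m ≤ a) (hmb : Y m ≤ b) (hd : Bad X Y S col d) (hc : col d = some !R)
    (hw : Protects X Y Z S col w d) (hu : ∀ w', Protects X Y Z S col w' d → w' = w)
    (hdb : b < Y d) : Z w < Z m := by
  obtain ⟨hmn, hk⟩ := C.left_nb hm hma hmb hd hc hw hu hdb
  have hmw : m ≠ w := fun h' => lt_irrefl _ (h' ▸ hm.2.2.1)
  by_contra hZ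
  replace hZ : Z m < Z w := lt_of_le_of_ne (not_lt.1 hZ) fun h' => hmw (C.injZ h')
  have hpm := hm.parent_right hZ
  obtain ⟨v, hv, hvc, hpv⟩ := hw.parent_killer hu hk hd hc
  replace hpv : Parent X Y Z S w v := hpv.resolve_right fun h' => by
    have := h'.unique C.injY hpm
    simp_all
  rcases C.inv.block C.maxi hw.1 hw.2.1 R with ⟨q, hq, hqc⟩ | ⟨e, he, hec, hwe, hue⟩
  · rcases hq with hq | hq
    · have := hq.left_unique C.injY hm
      simp_all
    · have hqv : X q ≤ X v := not_lt.1 fun h' => hq.2.2.2.2 v hv.1 ⟨h', hpv.2.2.1⟩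
      have := hd.window hc hq.2.1 (hqv.trans hv.2.1.1.le) (hq.2.2.2.1.trans hw.2.2.1.2).le
      cases R <;> simp_all
  · have hout := hd.not_window hc he hec
    by_cases hkw : Killer X Y Z S w e
    · rcases hout with hx | hy
      · exact (hkw.2.2 v hv.1 ⟨hv.2.1.1.trans hx, hpv.2.2.1.trans hkw.2.1.2⟩).not_gt hpv.2.1
      · exact (hkw.2.2 m hm.1 ⟨hm.2.2.1.trans hkw.2.1.1,
          hmb.trans_lt (hdb.trans hy)⟩).not_gt hZ
    · obtain ⟨v', hv', hvc', hpv'⟩ := hwe.parent_killer hue hkw he hec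
      rcases hpv' with hpv' | hpv'
      · have := hpv'.unique C.injX hpv
        subst this
        cases R <;> simp_all
      · have := hpv'.unique C.injY hpm
        simp_all

theorem Mono.left_nb_leftmost (C : Mono X Y Z S col a b R) {m w d : α} (hm : Nb X Y S m w)
    (hwa : X w ≤ a) (hmb : Y m ≤ b) (hd : Bad X Y S col d) (hc : col d = some !R)
    (hw : Protects X Y Z S col w d) (hu : ∀ w', Protects X Y Z S col w' d → w' = w)
    (hdb : b < Y d) {l : α} (hl : l ∈ S) (hlb : Y l ≤ b) : X m ≤ X l := by
  have hma := hm.2.2.1.le.trans hwa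
  have hwb := hm.2.2.2.1.le.trans hmb
  obtain ⟨hmn, -⟩ := C.left_nb hm hma hmb hd hc hw hu hdb
  have hZ := C.left_nb_newer hm hma hmb hd hc hw hu hdb
  have hmw : m ≠ w := fun h' => lt_irrefl _ (h' ▸ hm.2.2.1)
  have hpw := hm.parent_left hZ
  have hwn := hw.2.1
  by_contra! hlm
  obtain ⟨l', hl'⟩ := exists_left_nb C.injY hm.alive_left hl hlm
  have hl'b : Y l' ≤ b := le_trans (not_lt.1 fun h' => hl'.2.2.2.2 l hl ⟨hlm, h'⟩) hlb
  have hl'a := hl'.2.2.1.le.trans hma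
  have hl'd : col l' ≠ some R := fun h' => by
    have := hd.window hc hl'.1 (hl'.2.2.1.trans (hm.2.2.1.trans hw.2.2.1.1)).le
      (hl'b.trans_lt hdb).le
    cases R <;> simp_all
  have hl'n : col l' = none := by
    have := C.mono l' hl'.1 hl'a hl'b
    tauto
  have hnb : ∀ c, ¬ ∃ q, (Nb X Y S q m ∨ Nb X Y S m q) ∧ col q = some c := by
    rintro c ⟨q, hq | hq, hqc⟩
    · have := hq.left_unique C.injY hl'
      simp_all
    · have := hq.right_unique C.injX hm
      simp_all
  obtain ⟨d', hd', hdc', hmd', hu'⟩ :=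
    (C.inv.block C.maxi hm.alive_left hmn (!R)).resolve_left (hnb _)
  have hout : a < X d' ∨ b < Y d' := by
    by_contra! h'
    have := C.mono d' hd'.1 h'.1 h'.2
    cases R <;> simp_all
  have hk' : ¬ Killer X Y Z S m d' := by
    rcases hout with h' | h'
    · exact fun hk => (hk.2.2 w hw.1.1 ⟨hwa.trans_lt h', hm.2.2.2.1.trans hk.2.1.2⟩).not_gt hZ
    · exact (C.left_nb hl' hl'a hl'b hd' hdc' hmd' hu' h').2
  obtain ⟨v', hv', hvc', hpv'⟩ := hmd'.parent_killer hu' hk' hd' hdc'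
  replace hpv' : Parent Y X Z S m v' := hpv'.resolve_left fun h' => by
    have := h'.unique C.injX hpw
    simp_all
  obtain ⟨e, he, hec, hme, hue⟩ :=
    (C.inv.block C.maxi hm.alive_left hmn R).resolve_left (hnb _)
  by_cases hkm : Killer X Y Z S m e
  · rcases hd.not_window hc he hec with hx | hy
    · exact (hkm.2.2 w hw.1.1 ⟨hw.2.2.1.1.trans hx, hm.2.2.2.1.trans hkm.2.1.2⟩).not_gt hZ
    · exact hl'.not_killer C.injZ hl'n
        ⟨hl'.2.2.1.trans hkm.2.1.1, hl'b.trans_lt (hdb.trans hy)⟩ hue hkm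
  · obtain ⟨v, hv, hvc, hpv⟩ := hme.parent_killer hue hkm he hec
    rcases hpv with hpv | hpv
    · have := hpv.unique C.injX hpw
      simp_all
    · have := hpv.unique C.injY hpv'
      subst this
      cases R <;> simp_all

theorem Mono.not_good (C : Mono X Y Z S col a b R) : ¬ Good X Y S col a b := by
  rintro (⟨p, hp, q, hq, hpa, hpb, hqa, hqb, h, h'⟩ | ⟨p, hp, hpa, hpb, hn, hd⟩)
  · have := C.mono p hp hpa hpb
    have := C.mono q hq hqa hqb
    cases R <;> simp_all
  · have := C.mono p hp hpa hpb
    simp_all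

theorem Mono.shrink (C : Mono X Y Z S col a b R) {a' b' : L} (ha : a' ≤ a) (hb : b' ≤ b) :
    Mono X Y Z S col a' b' R :=
  { C with mono := fun p hp h₁ h₂ => C.mono p hp (h₁.trans ha) (h₂.trans hb) }

variable (X Y Z S col a b R) in
/-- `w` is the right neighbor of the leftmost point of the window, inserted before it, and
lies below a bad point of the other color above the window. -/
def IsSecond (w : α) : Prop :=
  X w ≤ a ∧ ∃ m d, Nb X Y S m w ∧ Y m ≤ b ∧ (∀ l ∈ S, Y l ≤ b → X m ≤ X l) ∧ Z w < Z m ∧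
    Bad X Y S col d ∧ col d = some (!R) ∧ Below X Y w d ∧ b < Y d

/-- An uncolored minimal point of the window with points of the window on both sides is second
from the left or from the right. -/
theorem Mono.isSecond (C : Mono X Y Z S col a b R) {w p q : α} (hw : Alive X Y S w)
    (hwn : col w = none) (hwa : X w ≤ a) (hwb : Y w ≤ b) (hp : p ∈ S) (hpw : X p < X w)
    (hpb : Y p ≤ b) (hq : q ∈ S) (hqw : Y q < Y w) (hqa : X q ≤ a) :
    IsSecond X Y Z S col a b R w ∨ IsSecond Y X Z S col b a R w := by
  obtain ⟨m, hm⟩ := exists_left_nb C.injY hw hp hpw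
  obtain ⟨n, hn⟩ := exists_right_nb C.injX hw hq hqw
  have hmb : Y m ≤ b := le_trans (not_lt.1 fun h' => hm.2.2.2.2 p hp ⟨hpw, h'⟩) hpb
  have hna : X n ≤ a := le_trans (not_lt.1 fun h' => hn.2.2.2.2 q hq ⟨h', hqw⟩) hqa
  have hma := hm.2.2.1.le.trans hwa
  have hnb := hn.2.2.2.1.le.trans hwb
  rcases C.inv.block C.maxi hw hwn (!R) with ⟨r, hr | hr, hrc⟩ | ⟨d, hd, hdc, hwd, hu⟩
  · obtain rfl := hr.left_unique C.injY hm
    have := C.mono r hm.1 hma hmb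
    cases R <;> simp_all
  · obtain rfl := hr.right_unique C.injX hn
    have := C.mono r hn.2.1 hna hnb
    cases R <;> simp_all
  · by_cases hdb : b < Y d
    · exact Or.inl ⟨hwa, m, d, hm, hmb,
        fun l hl hlb => C.left_nb_leftmost hm hwa hmb hd hdc hwd hu hdb hl hlb,
        C.left_nb_newer hm hma hmb hd hdc hwd hu hdb, hd, hdc, hwd.2.2.1, hdb⟩
    · have hda : a < X d := by
        by_contra! h'
        have := C.mono d hd.1 h' (not_lt.1 hdb)
        cases R <;> simp_all
      have hd' := bad_swap.2 hd
      have hn' := nb_swap.2 hn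
      have hwd' := protects_swap.2 hwd
      have hu' : ∀ w', Protects Y X Z S col w' d → w' = w :=
        fun w' h' => hu w' (protects_swap.1 h')
      exact Or.inr ⟨hwb, n, d, hn', hna,
        fun l hl hla => C.swap.left_nb_leftmost hn' hwb hna hd' hdc hwd' hu' hda hl hla,
        C.swap.left_nb_newer hn' hnb hna hd' hdc hwd' hu' hda, hd', hdc, hwd'.2.2.1, hda⟩

variable (X Y S a b) in
/-- `z` is the leftmost point of the window. -/
def IsFirst (z : α) : Prop :=
  z ∈ S ∧ X z ≤ a ∧ Y z ≤ b ∧ ∀ l ∈ S, X l ≤ a → Y l ≤ b → X z ≤ X l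

theorem exists_isFirst (h : ∃ p ∈ S, X p ≤ a ∧ Y p ≤ b) : ∃ z, IsFirst X Y S a b z := by
  obtain ⟨p, hp⟩ := h
  obtain ⟨z, hz, hmin⟩ := {p ∈ S | X p ≤ a ∧ Y p ≤ b}.exists_min_image X ⟨p, by simpa using hp⟩
  simp only [mem_filter, and_imp] at hz hmin
  exact ⟨z, hz.1, hz.2.1, hz.2.2, hmin⟩

theorem IsSecond.nb (hX : X.Injective) {z w : α} (h : IsSecond X Y Z S col a b R w)
    (hz : IsFirst X Y S a b z) : Nb X Y S z w ∧ Parent X Y Z S z w := by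
  obtain ⟨hwa, m, d, hm, hmb, hmin, hZ, -⟩ := h
  obtain rfl : m = z := hX (le_antisymm (hmin z hz.1 hz.2.2.1)
    (hz.2.2.2 m hm.1 (hm.2.2.1.le.trans hwa) hmb))
  exact ⟨hm, hm.parent_left hZ⟩

theorem Mono.not_parent_of_isSecond (C : Mono X Y Z S col a b R) {w v : α}
    (h : IsSecond X Y Z S col a b R w) (hv : Parent Y X Z S w v) : b < Y v := by
  obtain ⟨hwa, m, d, hm, hmb, hmin, hZ, hd, hdc, hwd, hdb⟩ := h
  by_contra! hvb
  have h₁ := C.mono v hv.1 (hv.2.2.1.le.trans hwa) hvb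
  have h₂ := hd.window hdc hv.1 (hv.2.2.1.trans hwd.1).le (hvb.trans_lt hdb).le
  have hva : Alive X Y S v := by cases R <;> grind
  have hYm : Y m ≤ Y v := not_lt.1 fun h' => hm.2.2.2.2 v hv.1 ⟨hv.2.2.1, h'⟩
  have hmv : m ≠ v := fun h' => (h' ▸ hv.2.1).not_gt hZ
  exact hva.2 m hm.1 ⟨lt_of_le_of_ne (hmin v hv.1 hvb) fun h' => hmv (C.injX h'),
    lt_of_le_of_ne hYm fun h' => hmv (C.injY h')⟩

variable (X Y Z S col a b R) in
/-- The possible killers attached to the left end `z` of the window. -/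
def EndKiller (z v : α) : Prop :=
  v = z ∨ Parent X Y Z S z v ∨ ∃ w, IsSecond X Y Z S col a b R w ∧ Parent X Y Z S w v

open Classical in
theorem card_endKiller_le (hX : X.Injective) {z : α} (hz : IsFirst X Y S a b z) :
    #{v ∈ S | EndKiller X Y Z S col a b R z v} ≤ 3 := by
  have h₁ : #{v ∈ S | v = z} ≤ 1 := card_le_one.2 (by grind)
  have h₂ : #{v ∈ S | Parent X Y Z S z v} ≤ 1 := card_le_one.2 (by
    simp only [mem_filter, and_imp]
    exact fun v _ hv v' _ hv' => hv.unique hX hv')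
  have h₃ : #{v ∈ S | ∃ w, IsSecond X Y Z S col a b R w ∧ Parent X Y Z S w v} ≤ 1 :=
    card_le_one.2 (by
      simp only [mem_filter, and_imp]
      rintro v - ⟨w, hw, hv⟩ v' - ⟨w', hw', hv'⟩
      obtain rfl := (hw.nb hX hz).1.right_unique hX (hw'.nb hX hz).1
      exact hv.unique hX hv')
  have hsub : {v ∈ S | EndKiller X Y Z S col a b R z v} ⊆ {v ∈ S | v = z} ∪
      ({v ∈ S | Parent X Y Z S z v} ∪
        {v ∈ S | ∃ w, IsSecond X Y Z S col a b R w ∧ Parent X Y Z S w v}) := by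
    intro v
    simp only [mem_filter, mem_union]
    unfold EndKiller
    tauto
  have := card_le_card hsub
  have := card_union_le {v ∈ S | v = z} ({v ∈ S | Parent X Y Z S z v} ∪
    {v ∈ S | ∃ w, IsSecond X Y Z S col a b R w ∧ Parent X Y Z S w v})
  have := card_union_le {v ∈ S | Parent X Y Z S z v}
    {v ∈ S | ∃ w, IsSecond X Y Z S col a b R w ∧ Parent X Y Z S w v}
  lia

theorem Mono.endKiller (C : Mono X Y Z S col a b R) {z w v : α} (hz : IsFirst X Y S a b z)
    (hw : w = z ∨ IsSecond X Y Z S col a b R w) (hv : v ∈ S) (hva : X v ≤ a) (hvb : Y v ≤ b)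
    (h : v = w ∨ Parent X Y Z S w v ∨ Parent Y X Z S w v) :
    EndKiller X Y Z S col a b R z v := by
  rcases hw with rfl | hw
  · rcases h with h | h | h
    · exact Or.inl h
    · exact Or.inr (Or.inl h)
    · exact absurd (hz.2.2.2 v hv hva hvb) h.2.2.1.not_ge
  · rcases h with rfl | h | h
    · exact Or.inr (Or.inl (hw.nb C.injX hz).2)
    · exact Or.inr (Or.inr ⟨w, hw, h⟩)
    · exact absurd hvb (C.not_parent_of_isSecond hw h).not_ge

theorem IsFirst.lt (hX : X.Injective) {z w : α} (hz : IsFirst X Y S a b z) (hw : w ∈ S)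
    (hwa : X w ≤ a) (hwb : Y w ≤ b) (hne : w ≠ z) : X z < X w :=
  lt_of_le_of_ne (hz.2.2.2 w hw hwa hwb) fun h' => hne (hX h').symm

theorem Mono.exists_killer (C : Mono X Y Z S col a b R) {z z' e : α} (hz : IsFirst X Y S a b z)
    (hz' : IsFirst Y X S b a z') (he : e ∈ S) (hea : X e ≤ a) (heb : Y e ≤ b)
    (hed : ¬ Alive X Y S e) : ∃ v, Killer X Y Z S v e ∧
      (EndKiller X Y Z S col a b R z v ∨ EndKiller Y X Z S col b a R z' v) := by
  have hc : col e = some R := (C.mono e he hea heb).resolve_right fun h => hed h.2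
  obtain ⟨w, hwa, hwn, hwe, hw⟩ := C.inv.prot e
    ⟨he, hed, by simp [hc], (C.shrink hea heb).not_good⟩
  obtain ⟨v, hv, hvw⟩ : ∃ v, Killer X Y Z S v e ∧
      (v = w ∨ Parent X Y Z S w v ∨ Parent Y X Z S w v) := by
    rcases hw with hw | ⟨v, hv, hw⟩
    · exact ⟨w, hw, Or.inl rfl⟩
    · exact ⟨v, hv, Or.inr hw⟩
  have hxa := hwe.1.le.trans hea
  have hyb := hwe.2.le.trans heb
  have hva := hv.2.1.1.le.trans hea
  have hvb := hv.2.1.2.le.trans heb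
  have hcase : (w = z ∨ IsSecond X Y Z S col a b R w) ∨
      (w = z' ∨ IsSecond Y X Z S col b a R w) := by
    by_cases h₁ : w = z
    · exact Or.inl (Or.inl h₁)
    by_cases h₂ : w = z'
    · exact Or.inr (Or.inl h₂)
    exact (C.isSecond hwa hwn hxa hyb hz.1 (hz.lt C.injX hwa.1 hxa hyb h₁) hz.2.2.1 hz'.1
      (hz'.lt C.injY hwa.1 hyb hxa h₂) hz'.2.2.1).imp Or.inr Or.inr
  refine ⟨v, hv, hcase.imp (fun h => C.endKiller hz h hv.1 hva hvb hvw)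
    fun h => C.swap.endKiller hz' h hv.1 hvb hva (hvw.imp_right Or.symm)⟩

open Classical in
theorem Mono.card_dead_le (C : Mono X Y Z S col a b R) {z z' : α} (hz : IsFirst X Y S a b z)
    (hz' : IsFirst Y X S b a z') :
    #{e ∈ S | (X e ≤ a ∧ Y e ≤ b) ∧ ¬ Alive X Y S e} ≤ 6 := by
  have hk : ∀ e, ∃ v, e ∈ S → X e ≤ a → Y e ≤ b → ¬ Alive X Y S e → Killer X Y Z S v e ∧
      (EndKiller X Y Z S col a b R z v ∨ EndKiller Y X Z S col b a R z' v) := fun e => by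
    by_cases h : e ∈ S ∧ X e ≤ a ∧ Y e ≤ b ∧ ¬ Alive X Y S e
    · obtain ⟨v, hv⟩ := C.exists_killer hz hz' h.1 h.2.1 h.2.2.1 h.2.2.2
      exact ⟨v, fun _ _ _ _ => hv⟩
    · exact ⟨e, fun h₁ h₂ h₃ h₄ => absurd ⟨h₁, h₂, h₃, h₄⟩ h⟩
  choose k hk using hk
  have hcard : #{e ∈ S | (X e ≤ a ∧ Y e ≤ b) ∧ ¬ Alive X Y S e} ≤
      #({v ∈ S | EndKiller X Y Z S col a b R z v} ∪
        {v ∈ S | EndKiller Y X Z S col b a R z' v}) := by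
    refine card_le_card_of_injOn k (fun e he => ?_) fun e he e' he' hee => ?_
    · simp only [mem_coe, mem_filter] at he
      have := hk e he.1 he.2.1.1 he.2.1.2 he.2.2
      simpa [this.1.1] using this.2
    · simp only [mem_coe, mem_filter] at he he'
      by_contra hne
      have h₁ := (hk e he.1 he.2.1.1 he.2.1.2 he.2.2).1
      have h₂ := (hk e' he'.1 he'.2.1.1 he'.2.1.2 he'.2.2).1
      rw [← hee] at h₂
      have hc : ∀ e ∈ S, X e ≤ a → Y e ≤ b → ¬ Alive X Y S e → col e = some R :=
        fun e he hea heb hed => (C.mono e he hea heb).resolve_right fun h => hed h.2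
      exact C.not_good (C.inv.kil e e' _ R hne h₁ h₂ (hc e he.1 he.2.1.1 he.2.1.2 he.2.2)
        (hc e' he'.1 he'.2.1.1 he'.2.1.2 he'.2.2) a b he.2.1.1 he'.2.1.1 he.2.1.2 he'.2.1.2)
  have h₁ := card_endKiller_le (Z := Z) (col := col) (R := R) C.injX hz
  have h₂ := card_endKiller_le (Z := Z) (col := col) (R := R) C.injY hz'
  have := hcard.trans (card_union_le _ _)
  lia

open Classical in
theorem Mono.card_alive_le (C : Mono X Y Z S col a b R) {z z' : α} (hz : IsFirst X Y S a b z)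
    (hz' : IsFirst Y X S b a z') :
    #{e ∈ S | (X e ≤ a ∧ Y e ≤ b) ∧ Alive X Y S e} ≤ 5 := by
  set I : Finset α := {e ∈ S | (X e ≤ a ∧ Y e ≤ b) ∧ Alive X Y S e ∧ col e = some R ∧
    e ≠ z ∧ e ≠ z'}
  have hI : #I ≤ 1 := card_le_one.2 (by
    have key : ∀ r ∈ I, ∀ r' ∈ I, ¬ X r < X r' := by
      intro r hr r' hr' hlt
      simp only [I, mem_filter] at hr hr'
      obtain ⟨hrS, ⟨hra, hrb⟩, hral, hrc, hrz, hrz'⟩ := hr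
      obtain ⟨hrS', ⟨hra', hrb'⟩, hral', hrc', hrz2, hrz2'⟩ := hr'
      have hY := hral.lt_of_lt C.injY hral' hlt
      obtain ⟨s, hs⟩ := exists_right_nb C.injX hral hrS' hY
      have hsr : s ≠ r' := fun h' => C.inv.nb r s R hs hrc (h' ▸ hrc')
      have hXs : X s < X r' := lt_of_le_of_ne
        (not_lt.1 fun h' => hs.2.2.2.2 r' hrS' ⟨h', hY⟩) fun h' => hsr (C.injX h')
      have hsa := hXs.le.trans hra'
      have hsb := hs.2.2.2.1.le.trans hrb
      have hYs := hs.alive_right.lt_of_lt C.injY hral' hXs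
      have hsn := ((C.mono s hs.2.1 hsa hsb).resolve_left (C.inv.nb r s R hs hrc)).1
      rcases C.isSecond hs.alive_right hsn hsa hsb hrS hs.2.2.1 hrb hrS' hYs hra' with h | h
      · exact hrz (hs.left_unique C.injY (h.nb C.injX hz).1)
      · have hn := nb_swap.1 (h.nb C.injY hz').1
        refine hral'.2 z' hz'.1 ⟨lt_of_le_of_ne
          (not_lt.1 fun h' => hn.2.2.2.2 r' hrS' ⟨h', hYs⟩) fun h' => hrz2' (C.injX h').symm,
          hz'.lt C.injY hrS' hrb' hra' hrz2'⟩
    intro r hr r' hr'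
    exact C.injX (le_antisymm (not_lt.1 (key r' hr' r hr)) (not_lt.1 (key r hr r' hr'))))
  have hJ : #{w ∈ S | IsSecond X Y Z S col a b R w} ≤ 1 := card_le_one.2 (by
    simp only [mem_filter, and_imp]
    exact fun w _ hw w' _ hw' => (hw.nb C.injX hz).1.right_unique C.injX (hw'.nb C.injX hz).1)
  have hJ' : #{w ∈ S | IsSecond Y X Z S col b a R w} ≤ 1 := card_le_one.2 (by
    simp only [mem_filter, and_imp]
    exact fun w _ hw w' _ hw' =>
      (hw.nb C.injY hz').1.right_unique C.injY (hw'.nb C.injY hz').1)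
  have hsub : {e ∈ S | (X e ≤ a ∧ Y e ≤ b) ∧ Alive X Y S e} ⊆ {z, z'} ∪
      ({w ∈ S | IsSecond X Y Z S col a b R w} ∪
        ({w ∈ S | IsSecond Y X Z S col b a R w} ∪ I)) := by
    intro w hw
    simp only [mem_filter] at hw
    obtain ⟨hwS, ⟨hwa, hwb⟩, hwal⟩ := hw
    by_cases h₁ : w = z
    · simp [h₁]
    by_cases h₂ : w = z'
    · simp [h₂]
    rcases C.mono w hwS hwa hwb with hc | ⟨hc, -⟩
    · simp [I, hwS, hwa, hwb, hwal, hc, h₁, h₂]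
    · have := C.isSecond hwal hc hwa hwb hz.1 (hz.lt C.injX hwS hwa hwb h₁) hz.2.2.1 hz'.1
        (hz'.lt C.injY hwS hwb hwa h₂) hz'.2.2.1
      simp only [mem_union, mem_filter]
      tauto
  have h₀ := card_le_card hsub
  have h₁ := card_union_le {z, z'} ({w ∈ S | IsSecond X Y Z S col a b R w} ∪
        ({w ∈ S | IsSecond Y X Z S col b a R w} ∪ I))
  have h₂ := card_union_le {w ∈ S | IsSecond X Y Z S col a b R w}
        ({w ∈ S | IsSecond Y X Z S col b a R w} ∪ I)
  have h₃ := card_union_le {w ∈ S | IsSecond Y X Z S col b a R w} I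
  have h₄ := card_le_two (a := z) (b := z')
  lia

theorem Mono.card_le (C : Mono X Y Z S col a b R) : #{p ∈ S | X p ≤ a ∧ Y p ≤ b} ≤ 11 := by
  classical
  by_cases h : ∃ p ∈ S, X p ≤ a ∧ Y p ≤ b
  · obtain ⟨z, hz⟩ := exists_isFirst h
    obtain ⟨z', hz'⟩ := exists_isFirst (X := Y) (Y := X) (a := b) (b := a)
      (h.imp fun p hp => ⟨hp.1, hp.2.symm⟩)
    have h₁ := C.card_alive_le hz hz'
    have h₂ := C.card_dead_le hz hz'
    have h₃ := card_filter_add_card_filter_not (s := {p ∈ S | X p ≤ a ∧ Y p ≤ b})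
      (Alive X Y S)
    simp only [filter_filter] at h₃
    lia
  · have : {p ∈ S | X p ≤ a ∧ Y p ≤ b} = ∅ := by
      simpa [filter_eq_empty_iff] using h
    simp [this]

end Window

theorem Maximal.good_of_card (hX : X.Injective) (hY : Y.Injective) (hZ : Z.Injective)
    (hI : Inv X Y Z S col) (hM : Maximal X Y Z S col)
    (h : 12 ≤ #{p ∈ S | X p ≤ a ∧ Y p ≤ b}) : Good X Y S col a b := by
  by_contra hg
  obtain ⟨R, hR⟩ : ∃ R, ∀ p ∈ S, X p ≤ a → Y p ≤ b → col p ≠ some (!R) := by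
    by_contra! h'
    obtain ⟨p, hp, hpa, hpb, hpc⟩ := h' false
    obtain ⟨q, hq, hqa, hqb, hqc⟩ := h' true
    exact hg (good_of_ne hp hq hpa hpb hqa hqb hpc hqc)
  have C : Mono X Y Z S col a b R := ⟨hX, hY, hZ, hI, hM, fun p hp hpa hpb => by
    rcases hc : col p with _ | c
    · exact Or.inr ⟨rfl, by_contra fun h' => hg (Or.inr ⟨p, hp, hpa, hpb, hc, h'⟩)⟩
    · have := hR p hp hpa hpb
      cases R <;> cases c <;> simp_all⟩
  exact absurd C.card_le (by lia)

section Coloring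

theorem exists_maximal_coloring (hX : X.Injective) (hY : Y.Injective) (hZ : Z.Injective)
    (hS : ∀ p ∈ S, ∀ q ∈ S, Below X Y p q → Z q ≤ Z p) :
    ∃ col, Inv X Y Z S col ∧ ∀ a b c, 12 ≤ #{p ∈ {p ∈ S | Z p ≤ c} | X p ≤ a ∧ Y p ≤ b} →
      Good X Y {p ∈ S | Z p ≤ c} col a b := by
  classical
  induction S using Finset.induction_on_max_value Z with
  | empty =>
    refine ⟨fun _ => none, ⟨by simp, by simp, by simp [Bad], by simp⟩, fun a b c h => ?_⟩
    simp at h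
  | insert p S hpS hp ih =>
    obtain ⟨col, hI, hcol⟩ := ih fun q hq r hr =>
      hS q (mem_insert_of_mem hq) r (mem_insert_of_mem hr)
    have hlt : ∀ q ∈ S, Z q < Z p := fun q hq =>
      lt_of_le_of_ne (hp q hq) fun h' => hpS (hZ h' ▸ hq)
    obtain ⟨col', hI', hM', hext⟩ := (hI.insert_top hX hY hlt fun q hq hb =>
      (hS q (mem_insert_of_mem hq) p (mem_insert_self p S) hb).not_gt (hlt q hq)).exists_maximal
    refine ⟨col', hI', fun a b c h => ?_⟩
    by_cases hc : Z p ≤ c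
    · have hall : {q ∈ insert p S | Z q ≤ c} = insert p S := by
        refine filter_true_of_mem fun q hq => ?_
        rcases mem_insert.1 hq with rfl | hq
        · exact hc
        · exact (hp q hq).trans hc
      rw [hall] at h ⊢
      exact hM'.good_of_card hX hY hZ hI' h
    · have hfil : {q ∈ insert p S | Z q ≤ c} = {q ∈ S | Z q ≤ c} := by
        rw [filter_insert, if_neg hc]
      rw [hfil] at h ⊢
      refine (hcol a b c h).mono Subset.rfl fun q hq => (hext q).imp_right fun h' =>
        ⟨h'.1, hq, fun r hr => h'.2.2 r (mem_insert_of_mem (mem_filter.1 hr).1)⟩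

/-- Colors can be assigned so that each point of `D` differs from its prescribed partner, if
partners come strictly later. -/
theorem exists_forall_eq_not (D : Finset α) (k : α → α) (hk : ∀ p ∈ D, Z p < Z (k p))
    (F₀ : α → Bool) : ∃ F : α → Bool, (∀ p ∉ D, F p = F₀ p) ∧ ∀ p ∈ D, F p = !F (k p) := by
  classical
  induction D using Finset.induction_on_min_value Z with
  | empty => exact ⟨F₀, by simp⟩
  | insert p D hpD hp ih =>
    obtain ⟨F, hF, hF'⟩ := ih fun q hq => hk q (mem_insert_of_mem hq)
    have hne : ∀ q ∈ insert p D, k q ≠ p := fun q hq h' => by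
      have h₁ := hk q hq
      rw [h'] at h₁
      rcases mem_insert.1 hq with rfl | hq
      · exact lt_irrefl _ h₁
      · exact (hp q hq).not_gt h₁
    refine ⟨Function.update F p (!F (k p)), fun q hq => ?_, fun q hq => ?_⟩
    · rw [mem_insert, not_or] at hq
      rw [Function.update_of_ne hq.1, hF q hq.2]
    · rw [Function.update_of_ne (hne q hq)]
      rcases mem_insert.1 hq with rfl | hq
      · simp
      · rw [Function.update_of_ne (ne_of_mem_of_not_mem hq hpD), hF' q hq]

theorem exists_killer_of_not_alive {d : α} (hd : d ∈ S) (h : ¬ Alive X Y S d) :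
    ∃ v, Killer X Y Z S v d := by
  classical
  obtain ⟨q, hq, hqd⟩ : ∃ q ∈ S, Below X Y q d := by
    by_contra! h'
    exact h ⟨hd, h'⟩
  obtain ⟨v, hv, hmin⟩ := {q ∈ S | Below X Y q d}.exists_min_image Z
    ⟨q, mem_filter.2 ⟨hq, hqd⟩⟩
  simp only [mem_filter, and_imp] at hv hmin
  exact ⟨v, hv.1, hv.2, hmin⟩

theorem exists_coloring_of_antichain (hX : X.Injective) (hY : Y.Injective) (hZ : Z.Injective)
    (hS : ∀ p ∈ S, ∀ q ∈ S, Below X Y p q → Z q ≤ Z p) :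
    ∃ F : α → Bool, ∀ a b c, 12 ≤ #{p ∈ S | X p ≤ a ∧ Y p ≤ b ∧ Z p ≤ c} →
      ∀ i, ∃ p ∈ S, X p ≤ a ∧ Y p ≤ b ∧ Z p ≤ c ∧ F p = i := by
  classical
  obtain ⟨col, -, hcol⟩ := exists_maximal_coloring hX hY hZ hS
  have hk : ∀ d, ∃ v, d ∈ S → ¬ Alive X Y S d → Killer X Y Z S v d := fun d => by
    by_cases h : d ∈ S ∧ ¬ Alive X Y S d
    · exact (exists_killer_of_not_alive h.1 h.2).imp fun v hv _ _ => hv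
    · exact ⟨d, fun h₁ h₂ => absurd ⟨h₁, h₂⟩ h⟩
  choose k hk using hk
  obtain ⟨F, hF, hF'⟩ := exists_forall_eq_not (Z := Z)
    {d ∈ S | ¬ Alive X Y S d ∧ col d = none} k (fun d hd => by
      simp only [mem_filter] at hd
      have hkd := hk d hd.1 hd.2.1
      exact lt_of_le_of_ne (hS _ hkd.1 d hd.1 hkd.2.1) fun h' =>
        lt_irrefl _ ((hZ h').symm ▸ hkd.2.1.1)) fun p => (col p).getD true
  have hFc : ∀ p i, col p = some i → F p = i := fun p i hp => by
    rw [hF p (by simp [hp]), hp, Option.getD_some]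
  refine ⟨F, fun a b c h i => ?_⟩
  have hg := hcol a b c (h.trans (card_le_card fun p hp => by
    simp only [mem_filter] at hp ⊢
    tauto))
  rcases hg with ⟨p, hp, q, hq, hpa, hpb, hqa, hqb, hpc, hqc⟩ | ⟨p, hp, hpa, hpb, hpn, hpd⟩
  · rw [mem_filter] at hp hq
    cases i
    · exact ⟨q, hq.1, hqa, hqb, hq.2, hFc q _ hqc⟩
    · exact ⟨p, hp.1, hpa, hpb, hp.2, hFc p _ hpc⟩
  · obtain ⟨q, hq, hqp⟩ : ∃ q ∈ {q ∈ S | Z q ≤ c}, Below X Y q p := by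
      by_contra! h'
      exact hpd ⟨hp, h'⟩
    rw [mem_filter] at hp hq
    have hpd' : ¬ Alive X Y S p := fun h' => h'.2 q hq.1 hqp
    have hkp := hk p hp.1 hpd'
    have hFp := hF' p (mem_filter.2 ⟨hp.1, hpd', hpn⟩)
    have hkc := (hkp.2.2 q hq.1 hqp).trans hq.2
    by_cases hi : F p = i
    · exact ⟨p, hp.1, hpa, hpb, hp.2, hi⟩
    · refine ⟨k p, hkp.1, hkp.2.1.1.le.trans hpa, hkp.2.1.2.le.trans hpb, hkc, ?_⟩
      cases i <;> simp_all

/-- Points in general position can be two-colored so that every octant containing at least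
twelve of them contains both colors. -/
theorem exists_coloring (hX : X.Injective) (hY : Y.Injective) (hZ : Z.Injective)
    (P : Finset α) :
    ∃ F : α → Bool, ∀ a b c, 12 ≤ #{p ∈ P | X p ≤ a ∧ Y p ≤ b ∧ Z p ≤ c} →
      ∀ i, ∃ p ∈ P, X p ≤ a ∧ Y p ≤ b ∧ Z p ≤ c ∧ F p = i := by
  classical
  have hk : ∀ p, ∃ q, p ∈ P → (∃ r ∈ P, Below X Y r p ∧ Z r < Z p) →
      q ∈ P ∧ Below X Y q p ∧ Z q < Z p := fun p => by
    by_cases h : ∃ r ∈ P, Below X Y r p ∧ Z r < Z p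
    · exact h.imp fun r hr _ _ => hr
    · exact ⟨p, fun _ h' => absurd h' h⟩
  choose k hk using hk
  obtain ⟨F₀, hF₀⟩ := exists_coloring_of_antichain
    (S := {p ∈ P | ¬ ∃ r ∈ P, Below X Y r p ∧ Z r < Z p}) hX hY hZ (fun p hp q hq hpq => by
      simp only [mem_filter] at hp hq
      exact not_lt.1 fun h' => hq.2 ⟨p, hp.1, hpq, h'⟩)
  obtain ⟨F, hF, hF'⟩ := exists_forall_eq_not (Z := fun p => OrderDual.toDual (Z p))
    {p ∈ P | ∃ r ∈ P, Below X Y r p ∧ Z r < Z p} k (fun p hp => by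
      rw [mem_filter] at hp
      exact (hk p hp.1 hp.2).2.2) F₀
  refine ⟨F, fun a b c h i => ?_⟩
  by_cases hex : ∃ p ∈ P, (X p ≤ a ∧ Y p ≤ b ∧ Z p ≤ c) ∧ ∃ r ∈ P, Below X Y r p ∧ Z r < Z p
  · obtain ⟨p, hp, ⟨hpa, hpb, hpc⟩, hr⟩ := hex
    obtain ⟨hkP, hkb, hkZ⟩ := hk p hp hr
    have hFp := hF' p (mem_filter.2 ⟨hp, hr⟩)
    by_cases hi : F p = i
    · exact ⟨p, hp, hpa, hpb, hpc, hi⟩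
    · refine ⟨k p, hkP, hkb.1.le.trans hpa, hkb.2.le.trans hpb, hkZ.le.trans hpc, ?_⟩
      cases i <;> simp_all
  · have heq : {p ∈ {p ∈ P | ¬ ∃ r ∈ P, Below X Y r p ∧ Z r < Z p} |
        X p ≤ a ∧ Y p ≤ b ∧ Z p ≤ c} = {p ∈ P | X p ≤ a ∧ Y p ≤ b ∧ Z p ≤ c} := by
      rw [filter_filter]
      refine filter_congr fun p hp => ?_
      constructor
      · exact fun h' => h'.2
      · exact fun h' => ⟨fun hr => hex ⟨p, hp, h', hr⟩, h'⟩
    obtain ⟨p, hp, hpa, hpb, hpc, hi⟩ := hF₀ a b c (heq ▸ h) i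
    rw [mem_filter] at hp
    refine ⟨p, hp.1, hpa, hpb, hpc, ?_⟩
    rw [hF p fun h' => hp.2 (mem_filter.1 h').2, hi]

/-- The version of `exists_coloring` in which points may share coordinates. -/
theorem exists_coloring_of_functions {β : Type*} [LinearOrder β] (x y z : α → β)
    (P : Finset α) :
    ∃ F : α → Bool, ∀ a b c, 12 ≤ #{p ∈ P | x p ≤ a ∧ y p ≤ b ∧ z p ≤ c} →
      ∀ i, ∃ p ∈ P, x p ≤ a ∧ y p ≤ b ∧ z p ≤ c ∧ F p = i := by
  classical
  let n : P → ℕ := fun p => P.equivFin p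
  have hn : n.Injective := Fin.val_injective.comp P.equivFin.injective
  let lift : (α → β) → P → β ×ₗ ℕ := fun f p => toLex (f p, n p)
  have hinj : ∀ f, (lift f).Injective := fun f p q h =>
    hn (congrArg (fun u => (ofLex u).2) h)
  have hle : ∀ f p a, lift f p ≤ toLex (a, #P) ↔ f p ≤ a := fun f p a => by
    have hlt : n p < #P := (P.equivFin p).2
    simp only [lift, Prod.Lex.toLex_le_toLex]
    constructor
    · rintro (h | h)
      · exact h.le
      · exact h.1.le
    · exact fun h => h.lt_or_eq.imp_right fun h' => ⟨h', hlt.le⟩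
  obtain ⟨F, hF⟩ := exists_coloring (hinj x) (hinj y) (hinj z) univ
  refine ⟨fun p => if h : p ∈ P then F ⟨p, h⟩ else true, fun a b c h i => ?_⟩
  obtain ⟨p, -, hpa, hpb, hpc, hi⟩ :=
    hF (toLex (a, #P)) (toLex (b, #P)) (toLex (c, #P)) (h.trans (by
      simp only [hle]
      rw [← card_map (Function.Embedding.subtype _)]
      refine card_le_card fun p hp => ?_
      rw [mem_filter] at hp
      simpa using ⟨hp.2, hp.1⟩)) i
  rw [hle] at hpa hpb hpc
  exact ⟨p, p.2, hpa, hpb, hpc, by simpa using hi⟩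

end Coloring

end OctantColoring

/-- Any finite set of points in ℝ³ can be two-colored so that every translate of the
octant `W = {(x,y,z) : x ≤ 0, y ≤ 0, z ≤ 0}` containing at least 12 points of the set
contains points of both colors. -/
theorem octant_dual_coloring
    (W : Set (Fin 3 → ℝ)) (hW : W = {p | p 0 ≤ 0 ∧ p 1 ≤ 0 ∧ p 2 ≤ 0})
    (P : Finset (Fin 3 → ℝ)) :
    ∃ χ : (Fin 3 → ℝ) → Bool, ∀ t : Fin 3 → ℝ,
      12 ≤ ((P : Set (Fin 3 → ℝ)) ∩ (t + ·) '' W).ncard →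
      (∃ p ∈ (P : Set (Fin 3 → ℝ)) ∩ (t + ·) '' W, χ p = true) ∧
      (∃ q ∈ (P : Set (Fin 3 → ℝ)) ∩ (t + ·) '' W, χ q = false) := by
  have hmem : ∀ t p : Fin 3 → ℝ, p ∈ (t + ·) '' W ↔ p 0 ≤ t 0 ∧ p 1 ≤ t 1 ∧ p 2 ≤ t 2 := by
    simp [hW, add_comm]
  obtain ⟨F, hF⟩ := OctantColoring.exists_coloring_of_functions (· 0) (· 1) (· 2) P
  refine ⟨F, fun t ht => ?_⟩
  have hset : (P : Set (Fin 3 → ℝ)) ∩ (t + ·) '' W =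
      (P.filter fun p => p 0 ≤ t 0 ∧ p 1 ≤ t 1 ∧ p 2 ≤ t 2 : Finset (Fin 3 → ℝ)) := by
    ext p
    rw [Set.mem_inter_iff, hmem]
    simp
  rw [hset, Set.ncard_coe_finset] at ht
  have key : ∀ i, ∃ p ∈ (P : Set (Fin 3 → ℝ)) ∩ (t + ·) '' W, F p = i := fun i => by
    obtain ⟨p, hp, h₀, h₁, h₂, hi⟩ := hF (t 0) (t 1) (t 2) ht i
    exact ⟨p, ⟨hp, (hmem t p).2 ⟨h₀, h₁, h₂⟩⟩, hi⟩
  exact ⟨key true, key false⟩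
end

section
/- Let T be a nondegenerate triangle in ℝ². For every finite set P of points of ℝ² there exists a coloring χ : P → {red, blue} such that every positive homothetic copy of T (a set c + λ·T with λ > 0) that contains at least 12 points of P contains at least one red point of P and at least one blue point of P. -/
section OctantColoring

variable {α : Type*}

/-- The points of `S` in the closed lower-left quadrant with corner `(X, Y)`. -/
noncomputable def wedge (x y : α → ℝ) (X Y : ℝ) (S : Finset α) : Finset α :=
  S.filter fun p => x p ≤ X ∧ y p ≤ Y

/-- Every coloring of the family `F` uses both colors on `S`. -/
def Bichromatic (F : Set (α → Bool)) (S : Finset α) : Prop :=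
  ∀ χ ∈ F, ∃ p ∈ S, ∃ q ∈ S, χ p ≠ χ q

/-- The number of points of `C` is at most five and is controlled by the number of points
of `D` lying beyond points of `C` in the two coordinate directions. -/
def QuotaBounded (x y : α → ℝ) (D C : Finset α) : Prop :=
  C.Nonempty → C.card ≤ 5 ∧ ∃ s t : ℕ, s + t + 1 = C.card ∧
    (∃ u ∈ C, 3 * s ≤ (D.filter fun d => y u < y d).card + t) ∧
    (∃ v ∈ C, 3 * t ≤ (D.filter fun d => x v < x d).card + s)

/-- The invariant of the online coloring process on the set `P` of points seen so far: `F` is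
the family of colorings still allowed, `D` the set of points whose colors are completely free,
and `C c` the set of points painted with the color `c`. -/
structure PartialColoring (x y : α → ℝ) (m : ℕ) (P : Finset α) (F : Set (α → Bool))
    (D : Finset α) (C : Bool → Finset α) : Prop where
  free_subset : D ⊆ P
  painted_subset : ∀ c, C c ⊆ P
  congr : ∀ χ ∈ F, ∀ χ' : α → Bool, (∀ p ∈ P, χ' p = χ p) → χ' ∈ F
  extend : ∀ τ : α → Bool, ∃ χ ∈ F, ∀ d ∈ D, χ d = τ d
  painted : ∀ c, ∀ r ∈ C c, ∀ χ ∈ F, χ r = c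
  covered : ∀ q ∈ P, q ∉ D → (∀ c, q ∉ C c) → ∀ X Y, x q ≤ X → y q ≤ Y →
    Bichromatic F (wedge x y X Y P)
  antichain : ∀ d ∈ D, ∀ e ∈ D, d ≠ e → x d ≤ x e → y e < y d
  card_le : ∀ X Y, ¬ Bichromatic F (wedge x y X Y P) → (wedge x y X Y D).card ≤ m
  quota : ∀ X Y c, ¬ Bichromatic F (wedge x y X Y P) →
    QuotaBounded x y (wedge x y X Y D) (wedge x y X Y (C c))

variable {x y : α → ℝ} {X Y : ℝ} {S S' P D E : Finset α} {F F' : Set (α → Bool)}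
  {C : Bool → Finset α} {m : ℕ}

theorem mem_wedge {p : α} : p ∈ wedge x y X Y S ↔ p ∈ S ∧ x p ≤ X ∧ y p ≤ Y :=
  Finset.mem_filter

theorem wedge_mono (h : S ⊆ S') : wedge x y X Y S ⊆ wedge x y X Y S' :=
  Finset.filter_subset_filter _ h

theorem Bichromatic.mono (h : Bichromatic F S) (hF : F' ⊆ F) (hS : S ⊆ S') :
    Bichromatic F' S' := by
  intro χ hχ
  obtain ⟨p, hp, q, hq, hpq⟩ := h χ (hF hχ)
  exact ⟨p, hS hp, q, hS hq, hpq⟩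

theorem QuotaBounded.swap (h : QuotaBounded x y D E) : QuotaBounded y x D E := by
  intro hE
  obtain ⟨h5, s, t, hst, hu, hv⟩ := h hE
  exact ⟨h5, t, s, by omega, hv, hu⟩

theorem QuotaBounded.mono (h : QuotaBounded x y D E) (hD : D ⊆ S) : QuotaBounded x y S E := by
  intro hE
  obtain ⟨h5, s, t, hst, ⟨u, hu, hu'⟩, ⟨v, hv, hv'⟩⟩ := h hE
  refine ⟨h5, s, t, hst, ⟨u, hu, hu'.trans ?_⟩, ⟨v, hv, hv'.trans ?_⟩⟩ <;> gcongr

theorem quotaBounded_singleton (x y : α → ℝ) (D : Finset α) (e : α) :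
    QuotaBounded x y D {e} := fun _ => ⟨by simp, 0, 0, by simp, by simp, by simp⟩

/-- Painting one more point `e` preserves the quota when three free points beyond `e` have become
available that lie before all the points painted earlier. -/
theorem QuotaBounded.paint [DecidableEq α] (h : QuotaBounded x y D E) (hE : E.Nonempty) {e : α}
    (heD : e ∈ D) (heE : e ∉ E) (hD : D.card ≤ 7) {R : Finset α} (hR : R ⊆ D)
    (hR3 : R.card = 3) (heR : ∀ r ∈ R, y e < y r) (hRE : ∀ r ∈ R, ∀ u ∈ E, y r ≤ y u) :
    QuotaBounded x y (D.erase e) (insert e E) := by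
  intro _
  obtain ⟨h5, s, t, hst, ⟨u, hu, hu'⟩, ⟨v, hv, hv'⟩⟩ := h hE
  have hcard : (insert e E).card = E.card + 1 := Finset.card_insert_of_notMem heE
  have heu : y e ≤ y u := by
    obtain ⟨r, hr⟩ : R.Nonempty := Finset.card_pos.mp (by omega)
    exact (heR r hr).le.trans (hRE r hr u hu)
  have hdisj : Disjoint R (D.filter fun d => y u < y d) := by
    rw [Finset.disjoint_left]
    intro r hr hr'
    exact absurd (Finset.mem_filter.mp hr').2 (not_lt.mpr (hRE r hr u hu))
  have hbeyond : (D.filter fun d => y u < y d).card + 3 ≤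
      ((D.erase e).filter fun d => y e < y d).card := by
    rw [← hR3, add_comm, ← Finset.card_union_of_disjoint hdisj]
    apply Finset.card_le_card
    intro d hd
    rw [Finset.mem_filter, Finset.mem_erase]
    rcases Finset.mem_union.mp hd with hd | hd
    · have := heR d hd
      exact ⟨⟨fun h => by simp [h] at this, hR hd⟩, this⟩
    · rw [Finset.mem_filter] at hd
      have := heu.trans_lt hd.2
      exact ⟨⟨fun h => by simp [h] at this, hd.1⟩, this⟩
  have hloss : (D.filter fun d => x v < x d).card ≤
      ((D.erase e).filter fun d => x v < x d).card + 1 := by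
    rw [Finset.filter_erase]
    exact Nat.sub_le_iff_le_add.mp Finset.pred_card_le_card_erase
  have hD' : (D.erase e).card + 1 = D.card := Finset.card_erase_add_one heD
  have h1 := Finset.card_filter_le (D.erase e) fun d => y e < y d
  have h2 := Finset.card_filter_le (D.erase e) fun d => x v < x d
  refine ⟨by omega, s + 1, t, by omega, ⟨e, Finset.mem_insert_self _ _, by omega⟩,
    ⟨v, Finset.mem_insert_of_mem hv, by omega⟩⟩

theorem exists_median (hS : S.card = 7) (hx : Set.InjOn x S) :
    ∃ e ∈ S, (S.filter fun d => x d < x e).card = 3 ∧ (S.filter fun d => x e < x d).card = 3 := by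
  classical
  have hlt : ∀ e ∈ S, ∀ e' ∈ S, x e < x e' →
      (S.filter fun d => x d < x e).card < (S.filter fun d => x d < x e').card := by
    intro e he e' he' hee
    apply Finset.card_lt_card
    rw [Finset.ssubset_iff]
    refine ⟨e, by simp, fun d hd => ?_⟩
    rcases Finset.mem_insert.mp hd with rfl | hd
    · simp [he, hee]
    · rw [Finset.mem_filter] at hd ⊢
      exact ⟨hd.1, hd.2.trans hee⟩
  obtain ⟨e, he, h3⟩ : ∃ e ∈ S, (S.filter fun d => x d < x e).card = 3 := by
    have hmaps : Set.MapsTo (fun e => (S.filter fun d => x d < x e).card) S (Finset.range 7) := by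
      intro e he
      have : S.filter (fun d => x d < x e) ⊂ S :=
        Finset.filter_ssubset.mpr ⟨e, he, lt_irrefl _⟩
      simpa [hS] using Finset.card_lt_card this
    have hinj : Set.InjOn (fun e => (S.filter fun d => x d < x e).card) S := by
      intro e he e' he' hee
      rcases lt_trichotomy (x e) (x e') with h | h | h
      · exact absurd hee (hlt e he e' he' h).ne
      · exact hx he he' h
      · exact absurd hee (hlt e' he' e he h).ne'
    have := Finset.surjOn_of_injOn_of_card_le _ hmaps hinj (by simp [hS])
    exact this (show (3 : ℕ) ∈ (Finset.range 7 : Set ℕ) by simp)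
  refine ⟨e, he, h3, ?_⟩
  have h1 := Finset.card_filter_add_card_filter_not (s := S) fun d => x d < x e
  have h2 : S.filter (fun d => ¬ x d < x e) = insert e (S.filter fun d => x e < x d) := by
    ext d
    simp only [Finset.mem_filter, Finset.mem_insert, not_lt]
    constructor
    · rintro ⟨hd, hle⟩
      rcases hle.eq_or_lt with h | h
      · exact Or.inl (hx hd he h.symm)
      · exact Or.inr ⟨hd, h⟩
    · rintro (rfl | ⟨hd, h⟩)
      · exact ⟨he, le_rfl⟩
      · exact ⟨hd, h.le⟩
  rw [h2, Finset.card_insert_of_notMem (by simp)] at h1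
  omega

namespace PartialColoring

theorem eq_of_mem_of_not_bichromatic (h : PartialColoring x y m P F D C)
    (hW : ¬ Bichromatic F (wedge x y X Y P)) {c c' : Bool} {r r' : α}
    (hr : r ∈ wedge x y X Y (C c)) (hr' : r' ∈ wedge x y X Y (C c')) : c = c' := by
  by_contra hc
  refine hW fun χ hχ => ⟨r, wedge_mono (h.painted_subset c) hr, r',
    wedge_mono (h.painted_subset c') hr', ?_⟩
  rwa [h.painted c r (mem_wedge.mp hr).1 χ hχ, h.painted c' r' (mem_wedge.mp hr').1 χ hχ]

theorem notMem_painted (h : PartialColoring x y m P F D C) {e : α} (he : e ∈ D) (c : Bool) :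
    e ∉ C c := by
  intro hc
  obtain ⟨χ, hχ, hτ⟩ := h.extend fun _ => !c
  have := h.painted c e hc χ hχ
  simp [hτ e he] at this

theorem bichromatic_of_card (h : PartialColoring x y 6 P F D C)
    (hW : 12 ≤ (wedge x y X Y P).card) : Bichromatic F (wedge x y X Y P) := by
  classical
  by_contra hbad
  have hD := h.card_le X Y hbad
  obtain ⟨c, hc⟩ : ∃ c, wedge x y X Y P ⊆ wedge x y X Y D ∪ wedge x y X Y (C c) := by
    have hcover : ∀ q ∈ wedge x y X Y P, q ∈ wedge x y X Y D ∨ ∃ c, q ∈ wedge x y X Y (C c) := by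
      intro q hq
      rw [mem_wedge] at hq
      by_contra! hcon
      exact hbad (h.covered q hq.1 (fun hd => hcon.1 (mem_wedge.mpr ⟨hd, hq.2⟩))
        (fun c hc => hcon.2 c (mem_wedge.mpr ⟨hc, hq.2⟩)) X Y hq.2.1 hq.2.2)
    by_cases hex : ∃ c r, r ∈ wedge x y X Y (C c)
    · obtain ⟨c, r, hr⟩ := hex
      refine ⟨c, fun q hq => Finset.mem_union.mpr ((hcover q hq).imp_right ?_)⟩
      rintro ⟨c', hc'⟩
      rwa [h.eq_of_mem_of_not_bichromatic hbad hr hc']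
    · push Not at hex
      exact ⟨true, fun q hq => Finset.mem_union.mpr
        ((hcover q hq).imp_right fun ⟨c, hc⟩ => absurd hc (hex c q))⟩
  have hC : (wedge x y X Y (C c)).card ≤ 5 := by
    rcases (wedge x y X Y (C c)).eq_empty_or_nonempty with he | hne
    · simp [he]
    · exact (h.quota X Y c hbad hne).1
  have := (Finset.card_le_card hc).trans (Finset.card_union_le _ _)
  omega

/-- Painting the median `e` of the free points of a critical wedge. -/
theorem paint [DecidableEq α] (h : PartialColoring x y 7 P F D C) {X₀ Y₀ : ℝ} {c : Bool}
    (hempty : wedge x y X₀ Y₀ (C c) = ∅)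
    (hsup : ∀ X Y, X₀ ≤ X → Y₀ ≤ Y → ¬ Bichromatic F (wedge x y X Y P) →
      wedge x y X Y (C c) = ∅)
    {e : α} (he : e ∈ wedge x y X₀ Y₀ D)
    (hleft : ((wedge x y X₀ Y₀ D).filter fun d => x d < x e).card = 3)
    (hright : ((wedge x y X₀ Y₀ D).filter fun d => x e < x d).card = 3) :
    PartialColoring x y 7 P {χ ∈ F | χ e = c} (D.erase e)
      (Function.update C c (insert e (C c))) := by
  have heD := (mem_wedge.mp he).1
  have hF : {χ ∈ F | χ e = c} ⊆ F := Set.sep_subset _ _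
  have hbad : ∀ X Y, ¬ Bichromatic {χ ∈ F | χ e = c} (wedge x y X Y P) →
      ¬ Bichromatic F (wedge x y X Y P) := fun X Y hn hb => hn (hb.mono hF subset_rfl)
  have hupd : ∀ c' r, r ∈ Function.update C c (insert e (C c)) c' ↔
      r ∈ C c' ∨ (c' = c ∧ r = e) := by
    intro c' r
    by_cases hc : c' = c
    · subst hc
      simp [or_comm]
    · simp [hc]
  refine ⟨(Finset.erase_subset _ _).trans h.free_subset, ?_, ?_, ?_, ?_, ?_, ?_, ?_, ?_⟩
  · intro c' r hr
    rcases (hupd c' r).mp hr with hr | ⟨-, rfl⟩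
    · exact h.painted_subset c' hr
    · exact h.free_subset heD
  · intro χ hχ χ' hχ'
    exact ⟨h.congr χ hχ.1 χ' hχ', (hχ' e (h.free_subset heD)).trans hχ.2⟩
  · intro τ
    obtain ⟨χ, hχ, hτ⟩ := h.extend (Function.update τ e c)
    refine ⟨χ, ⟨hχ, by simpa using hτ e heD⟩, fun d hd => ?_⟩
    rw [hτ d (Finset.mem_of_mem_erase hd), Function.update_of_ne (Finset.ne_of_mem_erase hd)]
  · intro c' r hr χ hχ
    rcases (hupd c' r).mp hr with hr | ⟨rfl, rfl⟩
    · exact h.painted c' r hr χ hχ.1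
    · exact hχ.2
  · intro q hq hqD hqC X Y hX hY
    refine (h.covered q hq (fun hd => ?_) (fun c' hc' => hqC c' ((hupd c' q).mpr (Or.inl hc')))
      X Y hX hY).mono hF subset_rfl
    refine hqD (Finset.mem_erase.mpr ⟨?_, hd⟩)
    rintro rfl
    exact hqC c ((hupd c q).mpr (Or.inr ⟨rfl, rfl⟩))
  · intro d hd d' hd'
    exact h.antichain d (Finset.mem_of_mem_erase hd) d' (Finset.mem_of_mem_erase hd')
  · intro X Y hb
    exact (Finset.card_le_card (wedge_mono (Finset.erase_subset _ _))).trans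
      (h.card_le X Y (hbad X Y hb))
  · intro X Y c' hb
    have hb' := hbad X Y hb
    have hq := h.quota X Y c' hb'
    have hcard := h.card_le X Y hb'
    have hD : wedge x y X Y (D.erase e) = (wedge x y X Y D).erase e := Finset.filter_erase _ _ _
    by_cases heW : x e ≤ X ∧ y e ≤ Y
    swap
    · have h1 : wedge x y X Y (Function.update C c (insert e (C c)) c') = wedge x y X Y (C c') := by
        ext r
        rw [mem_wedge, mem_wedge, hupd]
        constructor
        · rintro ⟨hr | ⟨-, rfl⟩, hr'⟩
          · exact ⟨hr, hr'⟩
          · exact absurd hr' heW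
        · exact fun hr => ⟨Or.inl hr.1, hr.2⟩
      rw [h1, hD, Finset.erase_eq_of_notMem fun hm => heW (mem_wedge.mp hm).2]
      exact hq
    by_cases hc : c' = c
    swap
    · intro hne
      exfalso
      obtain ⟨r, hr⟩ := hne
      rw [mem_wedge, hupd] at hr
      have hrC : r ∈ C c' := hr.1.resolve_right fun hh => hc hh.1
      refine hb fun χ hχ => ⟨r, mem_wedge.mpr ⟨h.painted_subset c' hrC, hr.2⟩, e,
        mem_wedge.mpr ⟨h.free_subset heD, heW⟩, ?_⟩
      rwa [h.painted c' r hrC χ hχ.1, hχ.2]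
    subst hc
    have h1 : wedge x y X Y (Function.update C c' (insert e (C c')) c') =
        insert e (wedge x y X Y (C c')) := by
      simp only [Function.update_self, wedge, Finset.filter_insert, if_pos heW]
    rw [h1, hD]
    rcases (wedge x y X Y (C c')).eq_empty_or_nonempty with hE | hE
    · rw [hE]
      exact quotaBounded_singleton _ _ _ _
    have heE : e ∉ wedge x y X Y (C c') := fun hm => h.notMem_painted heD c' (mem_wedge.mp hm).1
    have heDW : e ∈ wedge x y X Y D := mem_wedge.mpr ⟨heD, heW⟩
    have hout : ∀ u ∈ wedge x y X Y (C c'), x u ≤ X₀ → Y₀ < y u := by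
      intro u hu hxu
      by_contra! hyu
      have : u ∈ wedge x y X₀ Y₀ (C c') := mem_wedge.mpr ⟨(mem_wedge.mp hu).1, hxu, hyu⟩
      simp [hempty] at this
    rcases le_or_gt X₀ X with hX | hX
    · rcases le_or_gt Y₀ Y with hY | hY
      · rw [hsup X Y hX hY hb'] at hE
        simp at hE
      · refine (hq.swap.paint hE heDW heE hcard ?_ hright ?_ ?_).swap
        · intro d hd
          rw [Finset.mem_filter, mem_wedge] at hd
          have hde : d ≠ e := fun hh => by simp [hh] at hd
          have := h.antichain e heD d hd.1.1 hde.symm hd.2.le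
          exact mem_wedge.mpr ⟨hd.1.1, hd.1.2.1.trans hX, this.le.trans heW.2⟩
        · exact fun d hd => (Finset.mem_filter.mp hd).2
        · intro d hd u hu
          rw [Finset.mem_filter, mem_wedge] at hd
          by_contra! hlt
          have := hout u hu (hlt.le.trans hd.1.2.1)
          exact absurd ((mem_wedge.mp hu).2.2.trans_lt hY) this.not_gt
    · refine hq.paint hE heDW heE hcard ?_ hleft ?_ ?_
      · intro d hd
        rw [Finset.mem_filter, mem_wedge] at hd
        obtain ⟨u, hu⟩ := hE
        have := hout u hu ((mem_wedge.mp hu).2.1.trans hX.le)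
        exact mem_wedge.mpr ⟨hd.1.1, hd.2.le.trans heW.1,
          hd.1.2.2.trans (this.le.trans (mem_wedge.mp hu).2.2)⟩
      · intro d hd
        rw [Finset.mem_filter, mem_wedge] at hd
        exact h.antichain d hd.1.1 e heD (fun hh => by simp [hh] at hd) hd.2.le
      · intro d hd u hu
        rw [Finset.mem_filter, mem_wedge] at hd
        exact hd.1.2.2.trans (hout u hu ((mem_wedge.mp hu).2.1.trans hX.le)).le

theorem exists_stable (h : PartialColoring x y 7 P F D C) :
    ∃ F' ⊆ F, ∃ D' C', PartialColoring x y 6 P F' D' C' := by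
  classical
  induction hn : D.card using Nat.strong_induction_on generalizing F D C with
  | _ n ih =>
  by_cases hstable : ∀ X Y, ¬ Bichromatic F (wedge x y X Y P) → (wedge x y X Y D).card ≤ 6
  · exact ⟨F, subset_rfl, D, C, { h with card_le := hstable }⟩
  push Not at hstable
  obtain ⟨X₀, Y₀, hbad, h7, c, hempty, hsup⟩ : ∃ X₀ Y₀, ¬ Bichromatic F (wedge x y X₀ Y₀ P) ∧
      6 < (wedge x y X₀ Y₀ D).card ∧ ∃ c, wedge x y X₀ Y₀ (C c) = ∅ ∧
      ∀ X Y, X₀ ≤ X → Y₀ ≤ Y → ¬ Bichromatic F (wedge x y X Y P) →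
        wedge x y X Y (C c) = ∅ := by
    by_cases hcol : ∃ X₀ Y₀, ¬ Bichromatic F (wedge x y X₀ Y₀ P) ∧
        6 < (wedge x y X₀ Y₀ D).card ∧ ∃ c r, r ∈ wedge x y X₀ Y₀ (C c)
    · obtain ⟨X₀, Y₀, hbad, h7, c, r, hr⟩ := hcol
      have hsup : ∀ X Y, X₀ ≤ X → Y₀ ≤ Y → ¬ Bichromatic F (wedge x y X Y P) →
          wedge x y X Y (C !c) = ∅ := by
        intro X Y hX hY hb
        rw [Finset.eq_empty_iff_forall_notMem]
        intro r' hr'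
        rw [mem_wedge] at hr
        have hr'' : r ∈ wedge x y X Y (C c) :=
          mem_wedge.mpr ⟨hr.1, hr.2.1.trans hX, hr.2.2.trans hY⟩
        have := h.eq_of_mem_of_not_bichromatic hb hr'' hr'
        simp at this
      exact ⟨X₀, Y₀, hbad, h7, !c, hsup X₀ Y₀ le_rfl le_rfl hbad, hsup⟩
    · push Not at hcol
      obtain ⟨X₀, Y₀, hbad, h7⟩ := hstable
      have hsup : ∀ X Y, X₀ ≤ X → Y₀ ≤ Y → ¬ Bichromatic F (wedge x y X Y P) →
          wedge x y X Y (C true) = ∅ := by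
        intro X Y hX hY hb
        refine Finset.eq_empty_iff_forall_notMem.mpr (hcol X Y hb (h7.trans_le ?_) true)
        apply Finset.card_le_card
        intro d hd
        rw [mem_wedge] at hd ⊢
        exact ⟨hd.1, hd.2.1.trans hX, hd.2.2.trans hY⟩
      exact ⟨X₀, Y₀, hbad, h7, true, hsup X₀ Y₀ le_rfl le_rfl hbad, hsup⟩
  have hinj : Set.InjOn x (wedge x y X₀ Y₀ D : Set α) := by
    intro d hd e he hde
    rw [Finset.mem_coe, mem_wedge] at hd he
    by_contra hne
    exact (h.antichain d hd.1 e he.1 hne hde.le).asymm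
      (h.antichain e he.1 d hd.1 (Ne.symm hne) hde.ge)
  obtain ⟨e, he, hleft, hright⟩ :=
    exists_median (le_antisymm (h.card_le X₀ Y₀ hbad) h7) hinj
  have hlt : (D.erase e).card < n := hn ▸ Finset.card_erase_lt_of_mem (mem_wedge.mp he).1
  obtain ⟨F', hF', hstate⟩ := ih _ hlt (h.paint hempty hsup he hleft hright) rfl
  exact ⟨F', hF'.trans (Set.sep_subset _ _), hstate⟩

/-- A new point dominating an old one gets the opposite color. -/
theorem insert_of_dominating [DecidableEq α] (h : PartialColoring x y m P F D C) {p q : α}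
    (hp : p ∉ P) (hq : q ∈ P) (hx : x q ≤ x p) (hy : y q ≤ y p) :
    PartialColoring x y m (insert p P) {χ ∈ F | χ p = !χ q} D C := by
  have hF : {χ ∈ F | χ p = !χ q} ⊆ F := Set.sep_subset _ _
  have hP : P ⊆ insert p P := Finset.subset_insert _ _
  have hbad : ∀ X Y, ¬ Bichromatic {χ ∈ F | χ p = !χ q} (wedge x y X Y (insert p P)) →
      ¬ Bichromatic F (wedge x y X Y P) := fun X Y hn hb => hn (hb.mono hF (wedge_mono hP))
  refine ⟨h.free_subset.trans hP, fun c => (h.painted_subset c).trans hP, ?_, ?_, ?_, ?_,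
    h.antichain, fun X Y hb => h.card_le X Y (hbad X Y hb),
    fun X Y c hb => h.quota X Y c (hbad X Y hb)⟩
  · intro χ hχ χ' hχ'
    refine ⟨h.congr χ hχ.1 χ' fun r hr => hχ' r (hP hr), ?_⟩
    rw [hχ' p (Finset.mem_insert_self _ _), hχ' q (hP hq), hχ.2]
  · intro τ
    obtain ⟨χ, hχ, hτ⟩ := h.extend τ
    have hne : ∀ r ∈ P, r ≠ p := fun r hr hrp => hp (hrp ▸ hr)
    refine ⟨Function.update χ p (!χ q), ⟨h.congr χ hχ _ fun r hr => ?_, ?_⟩, fun d hd => ?_⟩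
    · rw [Function.update_of_ne (hne r hr)]
    · rw [Function.update_self, Function.update_of_ne (hne q hq)]
    · rw [Function.update_of_ne (hne d (h.free_subset hd)), hτ d hd]
  · exact fun c r hr χ hχ => h.painted c r hr χ hχ.1
  · intro r hr hrD hrC X Y hX hY
    rcases Finset.mem_insert.mp hr with rfl | hr
    · intro χ hχ
      refine ⟨r, mem_wedge.mpr ⟨Finset.mem_insert_self _ _, hX, hY⟩, q,
        mem_wedge.mpr ⟨hP hq, hx.trans hX, hy.trans hY⟩, ?_⟩
      rw [hχ.2]
      simp
    · exact (h.covered r hr hrD hrC X Y hX hY).mono hF (wedge_mono hP)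

/-- A new point dominating no old one becomes free, and the free points dominating it get
the opposite color. -/
theorem insert_of_not_dominating [DecidableEq α] (h : PartialColoring x y m P F D C) {p : α}
    (hp : p ∉ P) (hdom : ∀ q ∈ P, x q ≤ x p → y p < y q) :
    PartialColoring x y (m + 1) (insert p P)
      {χ ∈ F | ∀ b ∈ D, x p ≤ x b → y p ≤ y b → χ b = !χ p}
      (insert p (D.filter fun b => ¬ (x p ≤ x b ∧ y p ≤ y b))) C := by
  set F' := {χ ∈ F | ∀ b ∈ D, x p ≤ x b → y p ≤ y b → χ b = !χ p} with hF'
  have hF : F' ⊆ F := Set.sep_subset _ _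
  have hP : P ⊆ insert p P := Finset.subset_insert _ _
  have hpP : p ∈ insert p P := Finset.mem_insert_self _ _
  have hne : ∀ r ∈ P, r ≠ p := fun r hr hrp => hp (hrp ▸ hr)
  have hdominated : ∀ b ∈ D, x p ≤ x b → y p ≤ y b → ∀ X Y, x b ≤ X → y b ≤ Y →
      Bichromatic F' (wedge x y X Y (insert p P)) := by
    intro b hb hxb hyb X Y hX hY χ hχ
    refine ⟨b, mem_wedge.mpr ⟨hP (h.free_subset hb), hX, hY⟩, p,
      mem_wedge.mpr ⟨hpP, hxb.trans hX, hyb.trans hY⟩, ?_⟩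
    rw [hχ.2 b hb hxb hyb]
    simp
  have hbad : ∀ X Y, ¬ Bichromatic F' (wedge x y X Y (insert p P)) →
      ¬ Bichromatic F (wedge x y X Y P) := fun X Y hn hb => hn (hb.mono hF (wedge_mono hP))
  refine ⟨?_, fun c => (h.painted_subset c).trans hP, ?_, ?_, ?_, ?_, ?_, ?_, ?_⟩
  · exact Finset.insert_subset_insert _ ((Finset.filter_subset _ _).trans h.free_subset)
  · intro χ hχ χ' hχ'
    refine ⟨h.congr χ hχ.1 χ' fun r hr => hχ' r (hP hr), fun b hb hxb hyb => ?_⟩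
    rw [hχ' p hpP, hχ' b (hP (h.free_subset hb)), hχ.2 b hb hxb hyb]
  · intro τ
    obtain ⟨χ, hχ, hτ⟩ := h.extend fun d => if x p ≤ x d ∧ y p ≤ y d then !τ p else τ d
    refine ⟨Function.update χ p (τ p), ⟨h.congr χ hχ _ fun r hr => ?_, fun b hb hxb hyb => ?_⟩,
      fun d hd => ?_⟩
    · rw [Function.update_of_ne (hne r hr)]
    · rw [Function.update_self, Function.update_of_ne (hne b (h.free_subset hb)), hτ b hb,
        if_pos ⟨hxb, hyb⟩]
    · rcases Finset.mem_insert.mp hd with rfl | hd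
      · rw [Function.update_self]
      · rw [Finset.mem_filter] at hd
        rw [Function.update_of_ne (hne d (h.free_subset hd.1)), hτ d hd.1, if_neg hd.2]
  · exact fun c r hr χ hχ => h.painted c r hr χ hχ.1
  · intro r hr hrD hrC X Y hX hY
    rw [Finset.mem_insert, Finset.mem_filter] at hrD
    push Not at hrD
    have hr := Finset.mem_of_mem_insert_of_ne hr hrD.1
    by_cases hd : r ∈ D
    · exact hdominated r hd (hrD.2 hd).1 (hrD.2 hd).2 X Y hX hY
    · exact (h.covered r hr hd hrC X Y hX hY).mono hF (wedge_mono hP)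
  · intro d hd e he hde hx
    rw [Finset.mem_insert, Finset.mem_filter] at hd he
    rcases hd with rfl | ⟨hd, hd'⟩ <;> rcases he with rfl | ⟨he, he'⟩
    · exact absurd rfl hde
    · by_contra! hy
      exact he' ⟨hx, hy⟩
    · exact hdom d (h.free_subset hd) hx
    · exact h.antichain d hd e he hde hx
  · intro X Y hb
    refine le_trans ?_ (Nat.add_le_add_right (h.card_le X Y (hbad X Y hb)) 1)
    refine le_trans (Finset.card_le_card ?_) (Finset.card_insert_le p _)
    intro d hd
    rw [mem_wedge, Finset.mem_insert, Finset.mem_filter] at hd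
    rw [Finset.mem_insert, mem_wedge]
    exact hd.1.imp id fun hd' => ⟨hd'.1, hd.2⟩
  · intro X Y c hb
    refine (h.quota X Y c (hbad X Y hb)).mono fun d hd => ?_
    rw [mem_wedge] at hd
    rw [mem_wedge, Finset.mem_insert, Finset.mem_filter]
    exact ⟨Or.inr ⟨hd.1, fun hdp => hb (hdominated d hd.1 hdp.1 hdp.2 X Y hd.2.1 hd.2.2)⟩, hd.2⟩

theorem exists_insert [DecidableEq α] (h : PartialColoring x y 6 P F D C) {p : α} (hp : p ∉ P) :
    ∃ F' ⊆ F, ∃ D' C', PartialColoring x y 6 (insert p P) F' D' C' := by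
  by_cases hdom : ∃ q ∈ P, x q ≤ x p ∧ y q ≤ y p
  · obtain ⟨q, hq, hx, hy⟩ := hdom
    exact ⟨_, Set.sep_subset _ _, _, _, h.insert_of_dominating hp hq hx hy⟩
  · push Not at hdom
    obtain ⟨F', hF', D', C', h'⟩ := (h.insert_of_not_dominating hp hdom).exists_stable
    exact ⟨F', hF'.trans (Set.sep_subset _ _), D', C', h'⟩

end PartialColoring

/-- Points of a finite set with three real coordinates can be two-colored so that every
closed octant with at least twelve of the points contains both colors. -/
theorem exists_octant_coloring (x y z : α → ℝ) (P : Finset α) :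
    ∃ χ : α → Bool, ∀ X Y Z, 12 ≤ (P.filter fun p => x p ≤ X ∧ y p ≤ Y ∧ z p ≤ Z).card →
      ∃ p ∈ P.filter (fun p => x p ≤ X ∧ y p ≤ Y ∧ z p ≤ Z),
      ∃ q ∈ P.filter (fun p => x p ≤ X ∧ y p ≤ Y ∧ z p ≤ Z), χ p ≠ χ q := by
  classical
  suffices H : ∃ F D C, PartialColoring x y 6 P F D C ∧ ∀ X Y Z,
      12 ≤ (P.filter fun p => x p ≤ X ∧ y p ≤ Y ∧ z p ≤ Z).card →
      Bichromatic F (P.filter fun p => x p ≤ X ∧ y p ≤ Y ∧ z p ≤ Z) by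
    obtain ⟨F, D, C, h, hF⟩ := H
    obtain ⟨χ, hχ, -⟩ := h.extend fun _ => true
    exact ⟨χ, fun X Y Z h12 => hF X Y Z h12 χ hχ⟩
  induction P using Finset.induction_on_max_value z with
  | empty =>
    refine ⟨Set.univ, ∅, fun _ => ∅, ?_, by simp⟩
    constructor <;> simp [wedge, QuotaBounded]
  | insert p P hp hz ih =>
    obtain ⟨F, D, C, h, hF⟩ := ih
    obtain ⟨F', hF', D', C', h'⟩ := h.exists_insert hp
    refine ⟨F', D', C', h', fun X Y Z h12 => ?_⟩
    rcases le_or_gt (z p) Z with hpZ | hpZ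
    · have heq : (insert p P).filter (fun q => x q ≤ X ∧ y q ≤ Y ∧ z q ≤ Z) =
          wedge x y X Y (insert p P) := by
        apply Finset.filter_congr
        intro q hq
        have : z q ≤ Z := by
          rcases Finset.mem_insert.mp hq with rfl | hq
          · exact hpZ
          · exact (hz q hq).trans hpZ
        simp [this]
      rw [heq] at h12 ⊢
      exact h'.bichromatic_of_card h12
    · have hpn : ¬ (x p ≤ X ∧ y p ≤ Y ∧ z p ≤ Z) := fun hh => hpZ.not_ge hh.2.2
      rw [Finset.filter_insert, if_neg hpn] at h12 ⊢
      exact (hF X Y Z h12).mono hF' subset_rfl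

end OctantColoring

/-- A positive homothetic copy of a nondegenerate triangle is cut out by three inequalities
with fixed directions. -/
theorem exists_homothet_eq_octant {A B C : Fin 2 → ℝ} (hABC : AffineIndependent ℝ ![A, B, C]) :
    ∃ f : Fin 3 → (Fin 2 → ℝ) → ℝ, ∀ (c : Fin 2 → ℝ) (lam : ℝ), 0 < lam →
      ∃ r : Fin 3 → ℝ, ∀ p, p ∈ (fun x => c + lam • x) '' convexHull ℝ {A, B, C} ↔
        ∀ i, f i p ≤ r i := by
  have htop : affineSpan ℝ (Set.range ![A, B, C]) = ⊤ :=
    hABC.affineSpan_eq_top_iff_card_eq_finrank_add_one.mpr (by simp)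
  let b : AffineBasis (Fin 3) ℝ (Fin 2 → ℝ) := ⟨![A, B, C], hABC, htop⟩
  have hb : Set.range b = {A, B, C} := by
    change Set.range ![A, B, C] = _
    ext p
    simp only [Matrix.range_cons, Matrix.range_empty, Set.union_empty, Set.mem_union,
      Set.mem_singleton_iff, Set.mem_insert_iff]
  refine ⟨fun i p => -(b.coord i).linear p, fun c lam hlam =>
    ⟨fun i => lam * b.coord i 0 - (b.coord i).linear c, fun p => ?_⟩⟩
  have hmem : p ∈ (fun x => c + lam • x) '' convexHull ℝ {A, B, C} ↔
      lam⁻¹ • (p - c) ∈ convexHull ℝ {A, B, C} := by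
    constructor
    · rintro ⟨q, hq, rfl⟩
      simpa [smul_smul, hlam.ne'] using hq
    · intro hq
      exact ⟨_, hq, by simp [smul_smul, hlam.ne']⟩
  rw [hmem, ← hb, b.convexHull_eq_nonneg_coord]
  refine forall_congr' fun i => ?_
  have hcoord : lam * b.coord i (lam⁻¹ • (p - c)) =
      (b.coord i).linear p - (b.coord i).linear c + lam * b.coord i 0 := by
    have := congrFun (b.coord i).decomp (lam⁻¹ • (p - c))
    rw [this]
    simp only [Pi.add_apply, map_smul, map_sub, smul_eq_mul]
    field_simp
  rw [← mul_nonneg_iff_of_pos_left hlam, hcoord]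
  constructor <;> intro h <;> linarith

/-- Any finite planar point set can be two-colored so that every positive homothetic
copy of a given nondegenerate triangle containing at least 12 of the points contains
points of both colors. -/
theorem triangle_homothets_dual_coloring
    (A B C : Fin 2 → ℝ) (hABC : AffineIndependent ℝ ![A, B, C])
    (T : Set (Fin 2 → ℝ)) (hT : T = convexHull ℝ {A, B, C})
    (P : Finset (Fin 2 → ℝ)) :
    ∃ χ : (Fin 2 → ℝ) → Bool, ∀ (c : Fin 2 → ℝ) (lam : ℝ), 0 < lam →
      12 ≤ ((P : Set (Fin 2 → ℝ)) ∩ (fun x => c + lam • x) '' T).ncard →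
      (∃ p ∈ (P : Set (Fin 2 → ℝ)) ∩ (fun x => c + lam • x) '' T, χ p = true) ∧
      (∃ q ∈ (P : Set (Fin 2 → ℝ)) ∩ (fun x => c + lam • x) '' T, χ q = false) := by
  subst hT
  classical
  obtain ⟨f, hf⟩ := exists_homothet_eq_octant hABC
  obtain ⟨χ, hχ⟩ := exists_octant_coloring (f 0) (f 1) (f 2) P
  refine ⟨χ, fun c lam hlam hcard => ?_⟩
  obtain ⟨r, hr⟩ := hf c lam hlam
  have heq : (P : Set (Fin 2 → ℝ)) ∩ (fun x => c + lam • x) '' convexHull ℝ {A, B, C} =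
      (P.filter fun p => f 0 p ≤ r 0 ∧ f 1 p ≤ r 1 ∧ f 2 p ≤ r 2 : Finset (Fin 2 → ℝ)) := by
    ext p
    rw [Set.mem_inter_iff, hr, Finset.mem_coe, Finset.mem_coe, Finset.mem_filter,
      Fin.forall_fin_succ, Fin.forall_fin_two]
    rfl
  rw [heq, Set.ncard_coe_finset] at hcard
  obtain ⟨p, hp, q, hq, hpq⟩ := hχ _ _ _ hcard
  rw [← Finset.mem_coe, ← heq] at hp hq
  cases hcp : χ p <;> cases hcq : χ q
  · exact absurd (hcp.trans hcq.symm) hpq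
  · exact ⟨⟨q, hq, hcq⟩, ⟨p, hp, hcp⟩⟩
  · exact ⟨⟨p, hp, hcp⟩, ⟨q, hq, hcq⟩⟩
  · exact absurd (hcp.trans hcq.symm) hpq
end

section
/- Let W = {(x,y,z) ∈ ℝ³ : x ≤ 0, y ≤ 0, z ≤ 0}. There exists a set P of 10 points in ℝ³ whose projections onto the z = 0 plane are pairwise incomparable (for any two distinct points of P, one has strictly smaller x-coordinate and strictly larger y-coordinate than the other), such that for every coloring χ : P → {red, blue} there exists a translate t + W of W whose intersection with P consists of exactly 3 points, all of the same color. -/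
/-- The heights of the ten points, listed from left to right. -/
def height : Fin 10 → Fin 10 := ![0, 5, 9, 8, 1, 7, 6, 4, 3, 2]

/-- The indices in the interval `[l, r]` of the points of height at most `c`. -/
def octantTrace (l r c : Fin 10) : Finset (Fin 10) :=
  {i | l ≤ i ∧ i ≤ r ∧ height i ≤ c}

/-- The `i`-th point from the left: the projections lie on the line `y = -x`. -/
noncomputable def point (i : Fin 10) : Fin 3 → ℝ :=
  ![(i : ℕ), -((i : ℕ) : ℝ), (height i : ℕ)]

theorem exists_monochromatic_octantTrace (f : Fin 10 → Bool) :
    ∃ l r c, (octantTrace l r c).card = 3 ∧ ∃ b, ∀ i ∈ octantTrace l r c, f i = b := by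
  by_contra! h
  have not_mono {l r c : Fin 10} (i j k : Fin 10) (hcard : (octantTrace l r c).card = 3)
      (htrace : octantTrace l r c = {i, j, k}) : ¬ (f i = f j ∧ f i = f k) := by
    rintro ⟨hj, hk⟩
    obtain ⟨m, hm, hne⟩ := h l r c hcard (f i)
    rw [htrace] at hm
    grind
  have h049 := not_mono (l := 0) (r := 9) (c := 2) 0 4 9 (by decide) (by decide)
  have h048 := not_mono (l := 0) (r := 8) (c := 3) 0 4 8 (by decide) (by decide)
  have h047 := not_mono (l := 0) (r := 7) (c := 4) 0 4 7 (by decide) (by decide)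
  have h789 := not_mono (l := 7) (r := 9) (c := 9) 7 8 9 (by decide) (by decide)
  have h147 := not_mono (l := 1) (r := 7) (c := 5) 1 4 7 (by decide) (by decide)
  have h146 := not_mono (l := 1) (r := 6) (c := 6) 1 4 6 (by decide) (by decide)
  have h145 := not_mono (l := 1) (r := 5) (c := 7) 1 4 5 (by decide) (by decide)
  have h567 := not_mono (l := 5) (r := 7) (c := 9) 5 6 7 (by decide) (by decide)
  have h013 := not_mono (l := 0) (r := 3) (c := 8) 0 1 3 (by decide) (by decide)
  have h012 := not_mono (l := 0) (r := 2) (c := 9) 0 1 2 (by decide) (by decide)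
  have h234 := not_mono (l := 2) (r := 4) (c := 9) 2 3 4 (by decide) (by decide)
  clear h not_mono
  cases h0 : f 0 <;> cases h1 : f 1 <;> cases h2 : f 2 <;> cases h4 : f 4 <;>
    cases h7 : f 7 <;> grind

theorem point_injective : Function.Injective point := by
  intro i j h
  have h0 := congrFun h 0
  simp only [point, Matrix.cons_val_zero, Nat.cast_inj] at h0
  exact Fin.ext h0

theorem range_point_inter_octant (l r c : Fin 10) :
    Set.range point ∩ ((![(r : ℕ), -((l : ℕ) : ℝ), (c : ℕ)] : Fin 3 → ℝ) + ·) ''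
        {q : Fin 3 → ℝ | q 0 ≤ 0 ∧ q 1 ≤ 0 ∧ q 2 ≤ 0} =
      point '' (octantTrace l r c : Set (Fin 10)) := by
  rw [Set.image_add_left, Set.inter_comm, ← Set.image_preimage_eq_inter_range]
  congr 1
  ext i
  simp only [octantTrace, point, Set.mem_preimage, Set.mem_ofPred_eq, Finset.coe_filter,
    Finset.mem_univ, true_and, Pi.add_apply, Pi.neg_apply, Matrix.cons_val, neg_add_nonpos_iff,
    neg_le_neg_iff, Nat.cast_le, Fin.val_fin_le]
  tauto

/-- There is a 10-point set in ℝ³ with pairwise incomparable projections onto the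
z = 0 plane such that in any two-coloring there is a translate of the octant `W`
containing exactly 3 points of the set, all of the same color. -/
theorem octant_lower_bound_ten_points
    (W : Set (Fin 3 → ℝ)) (hW : W = {q | q 0 ≤ 0 ∧ q 1 ≤ 0 ∧ q 2 ≤ 0}) :
    ∃ P : Finset (Fin 3 → ℝ), P.card = 10 ∧
      (∀ p ∈ P, ∀ q ∈ P, p ≠ q →
        (p 0 < q 0 ∧ q 1 < p 1) ∨ (q 0 < p 0 ∧ p 1 < q 1)) ∧
      ∀ χ : (Fin 3 → ℝ) → Bool, ∃ t : Fin 3 → ℝ,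
        ((P : Set (Fin 3 → ℝ)) ∩ (t + ·) '' W).ncard = 3 ∧
        ∃ b : Bool, ∀ p ∈ (P : Set (Fin 3 → ℝ)) ∩ (t + ·) '' W, χ p = b := by
  subst hW
  refine ⟨Finset.univ.map ⟨point, point_injective⟩, by simp, ?_, fun χ ↦ ?_⟩
  · simp only [Finset.mem_map, Finset.mem_univ, true_and, Function.Embedding.coeFn_mk]
    rintro _ ⟨i, rfl⟩ _ ⟨j, rfl⟩ hij
    simpa [point] using lt_or_gt_of_ne (ne_of_apply_ne point hij)
  · obtain ⟨l, r, c, hcard, b, hb⟩ := exists_monochromatic_octantTrace (χ ∘ point)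
    refine ⟨![(r : ℕ), -((l : ℕ) : ℝ), (c : ℕ)], ?_⟩
    rw [Finset.coe_map, Function.Embedding.coeFn_mk, Finset.coe_univ, Set.image_univ,
      range_point_inter_octant]
    refine ⟨?_, b, ?_⟩
    · rw [Set.ncard_image_of_injective _ point_injective, Set.ncard_coe_finset, hcard]
    · rintro _ ⟨i, hi, rfl⟩
      exact hb i hi
end
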